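/- Suppose the grouplikes of H have order p and that P₁^{g,E} = 0 = P₁^{E,g} for every g ∈ G(H) and every simple subcoalgebra E of H of dimension > 1. Then P^{g,E} = 0 = P^{E,g} for all such g and E. If moreover H contains a sub-Hopf algebra T isomorphic to the Taft algebra T_q of dimension p², then Σ_{g,h ∈ G(H)} P^{g,h} ⊕ kG(H) = T, and if every simple subcoalgebra of H of dimension greater than 1 has dimension divisible by d² with 1 < d² < p², then d² divides p−1. -/

import Mathlib

open TensorProduct

namespace HopfClass

variable (k : Type*) [Field k]

section Wrt

variable {M : Type*} [AddCommGroup M] [Module k M]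

/-- A subspace `C` is a subcoalgebra with respect to a comultiplication-like map `Δ`
if `Δ` maps `C` into the image of `C ⊗ C` in `M ⊗ M`. -/
def IsSubcoalgWrt (Δ : M →ₗ[k] M ⊗[k] M) (C : Submodule k M) : Prop :=
  ∀ x ∈ C, Δ x ∈ LinearMap.range (TensorProduct.map C.subtype C.subtype)

/-- A simple subcoalgebra: a nonzero subcoalgebra with no nonzero proper subcoalgebras. -/
def IsSimpleSubcoalgWrt (Δ : M →ₗ[k] M ⊗[k] M) (C : Submodule k M) : Prop :=
  IsSubcoalgWrt k Δ C ∧ C ≠ ⊥ ∧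
    ∀ D : Submodule k M, IsSubcoalgWrt k Δ D → D < C → D = ⊥

/-- Pointedness: every simple subcoalgebra is one-dimensional. -/
def IsPointedWrt (Δ : M →ₗ[k] M ⊗[k] M) : Prop :=
  ∀ C : Submodule k M, IsSimpleSubcoalgWrt k Δ C → Module.finrank k C = 1

/-- Grouplike element with respect to `Δ`. -/
def IsGrouplikeWrt (Δ : M →ₗ[k] M ⊗[k] M) (g : M) : Prop :=
  g ≠ 0 ∧ Δ g = g ⊗ₜ[k] g

/-- `y` is a `(h, g)`-skew-primitive with respect to `Δ`, i.e. `Δ y = g ⊗ y + y ⊗ h`. -/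
def IsSkewPrimitiveWrt (Δ : M →ₗ[k] M ⊗[k] M) (g h y : M) : Prop :=
  Δ y = g ⊗ₜ[k] y + y ⊗ₜ[k] h

/-- There are no nontrivial skew-primitive elements: every skew-primitive between grouplikes
is a scalar multiple of the difference of the grouplikes. -/
def HasNoNontrivialSkewPrimitivesWrt (Δ : M →ₗ[k] M ⊗[k] M) : Prop :=
  ∀ g h y : M, IsGrouplikeWrt k Δ g → IsGrouplikeWrt k Δ h →
    IsSkewPrimitiveWrt k Δ g h y → ∃ c : k, y = c • (g - h)

end Wrt

section Coalg

variable (H : Type*) [AddCommGroup H] [Module k H] [Coalgebra k H]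

/-- The comultiplication of a coalgebra, as a linear map. -/
noncomputable abbrev comulL : H →ₗ[k] H ⊗[k] H := CoalgebraStruct.comul

/-- The coradical of a coalgebra: the sum of all its simple subcoalgebras. -/
noncomputable def coradical : Submodule k H :=
  sSup {C : Submodule k H | IsSimpleSubcoalgWrt k (comulL k H) C}

/-- A coalgebra is cosemisimple if it equals its coradical. -/
def IsCosemisimple : Prop := coradical k H = ⊤

/-- A coalgebra is pointed if all its simple subcoalgebras are one-dimensional. -/
def IsPointed : Prop := IsPointedWrt k (comulL k H)

/-- The set of grouplike elements. -/
def grouplikes : Set H := {g : H | IsGrouplikeWrt k (comulL k H) g}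

/-- `e` is a multiplicative matrix of size `n` spanning the subspace `C`, i.e. a
linearly independent family with `Δ(e i j) = ∑ l, e i l ⊗ e l j` and `ε(e i j) = δ_ij`
whose span is `C`; this says precisely that `C` is a simple matrix subcoalgebra
isomorphic to `M*(n,k)`, the dual of the `n × n` matrix algebra. -/
def IsMultMatrix (n : ℕ) (C : Submodule k H) (e : Fin n → Fin n → H) : Prop :=
  LinearIndependent k (fun p : Fin n × Fin n => e p.1 p.2) ∧
  C = Submodule.span k (Set.range fun p : Fin n × Fin n => e p.1 p.2) ∧
  (∀ i j, CoalgebraStruct.comul (R := k) (e i j) = ∑ l : Fin n, e i l ⊗ₜ[k] e l j) ∧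
  (∀ i j, Coalgebra.counit (R := k) (e i j) = if i = j then (1 : k) else 0)

/-- `C` is a (simple matrix) subcoalgebra isomorphic to the matrix coalgebra `M*(n,k)`. -/
def IsMatrixSubcoalg (n : ℕ) (C : Submodule k H) : Prop :=
  ∃ e : Fin n → Fin n → H, IsMultMatrix k H n C e

end Coalg

section Dual

variable (H : Type*) [Ring H] [Algebra k H] [FiniteDimensional k H]

/-- The comultiplication on the dual of a finite-dimensional algebra:
the dual map of the multiplication, composed with the canonical identification
`(H ⊗ H)* ≃ H* ⊗ H*`. -/
noncomputable def dualComul :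
    Module.Dual k H →ₗ[k] Module.Dual k H ⊗[k] Module.Dual k H :=
  (TensorProduct.dualDistribEquiv k H H).symm.toLinearMap ∘ₗ
    (LinearMap.mul' k H).dualMap

/-- A finite-dimensional Hopf algebra is copointed if its dual is pointed. -/
def IsCopointed : Prop := IsPointedWrt k (dualComul k H)

/-- The grouplike elements of the dual Hopf algebra. -/
def dualGrouplikes : Set (Module.Dual k H) :=
  {f : Module.Dual k H | IsGrouplikeWrt k (dualComul k H) f}

end Dual

section Taft

variable (p : ℕ) (q : k)

/-- `B` is (isomorphic to) the Taft Hopf algebra `T_q` of dimension `p²`: `q` is a primitive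
`p`-th root of unity, `B` has dimension `p²` and is generated as an algebra by a grouplike `g`
and a `(1,g)`-skew-primitive `x` with `g^p = 1`, `x^p = 0` and `g x = q x g`. -/
def IsTaftAlgebra (B : Type*) [Ring B] [Bialgebra k B] : Prop :=
  IsPrimitiveRoot q p ∧ Module.finrank k B = p ^ 2 ∧
  ∃ g x : B,
    IsGrouplikeWrt k (comulL k B) g ∧
    CoalgebraStruct.comul (R := k) x = x ⊗ₜ[k] (1 : B) + g ⊗ₜ[k] x ∧
    g ^ p = 1 ∧ x ^ p = 0 ∧ g * x = q • (x * g) ∧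
    Algebra.adjoin k {g, x} = (⊤ : Subalgebra k B)

variable {H : Type*} [Ring H] [Bialgebra k H]

/-- The subalgebra `T` of `H` is a sub-Hopf algebra isomorphic to the Taft algebra `T_q` of
dimension `p²`, generated by a grouplike `g` and a `(1,g)`-skew-primitive `x` satisfying the
Taft relations. -/
def IsTaftSubalgebra (T : Subalgebra k H) : Prop :=
  IsPrimitiveRoot q p ∧ Module.finrank k T = p ^ 2 ∧
  ∃ g x : H,
    IsGrouplikeWrt k (comulL k H) g ∧
    CoalgebraStruct.comul (R := k) x = x ⊗ₜ[k] (1 : H) + g ⊗ₜ[k] x ∧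
    g ^ p = 1 ∧ x ^ p = 0 ∧ g * x = q • (x * g) ∧
    Algebra.adjoin k {g, x} = T

/-- The right coinvariants `H^{co π}` of a linear map `π : H → B` on a bialgebra `H`:
elements `h` with `(id ⊗ π)(Δ h) = h ⊗ 1`. -/
def rightCoinvariants {B : Type*} [Ring B] [Bialgebra k B] (π : H →ₗ[k] B) : Set H :=
  {h : H | (TensorProduct.map LinearMap.id π) (CoalgebraStruct.comul (R := k) h)
      = h ⊗ₜ[k] (1 : B)}

end Taft

end HopfClass

namespace HopfClass

variable (k : Type*) [Field k]
variable (H : Type*) [AddCommGroup H] [Module k H] [Coalgebra k H]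

/-- The image of `A ⊗ B` in `H ⊗ H`, for subspaces `A, B` of `H`. -/
noncomputable def tensorSM (A B : Submodule k H) : Submodule k (H ⊗[k] H) :=
  LinearMap.range (TensorProduct.map A.subtype B.subtype)

/-- Nichols' description of the coradical filtration relative to a coalgebra projection
`π₀ : H → H₀` with kernel `I = ker π₀`:
`P 0 = 0`, `P 1 = I ∩ Δ⁻¹(H₀ ⊗ I + I ⊗ H₀)`, and for `n ≥ 2`,
`P n = {x ∈ I | Δ x − (π₀ ⊗ id) Δ x − (id ⊗ π₀) Δ x ∈ ∑_{i=1}^{n−1} P i ⊗ P (n−i)}`. -/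
noncomputable def Pfilt (π₀ : H →ₗ[k] H) : ℕ → Submodule k H
  | 0 => ⊥
  | 1 => LinearMap.ker π₀ ⊓ Submodule.comap (comulL k H)
      (tensorSM k H (coradical k H) (LinearMap.ker π₀) ⊔
        tensorSM k H (LinearMap.ker π₀) (coradical k H))
  | (n + 2) => LinearMap.ker π₀ ⊓ Submodule.comap
      (comulL k H - TensorProduct.map π₀ LinearMap.id ∘ₗ comulL k H -
        TensorProduct.map LinearMap.id π₀ ∘ₗ comulL k H)
      (⨆ i : Fin (n + 1), tensorSM k H (Pfilt π₀ (i + 1)) (Pfilt π₀ (n + 1 - i)))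

/-- The isotypic component `P_n^{C,D}` of the `H₀`-bicomodule `P_n` with coefficient
coalgebras `C` (on the left, via `ρ_L = (π₀ ⊗ id)Δ`) and `D` (on the right, via
`ρ_R = (id ⊗ π₀)Δ`). -/
noncomputable def Pcomp (π₀ : H →ₗ[k] H) (n : ℕ) (C D : Submodule k H) : Submodule k H :=
  Pfilt k H π₀ n ⊓
    Submodule.comap (TensorProduct.map π₀ LinearMap.id ∘ₗ comulL k H)
      (tensorSM k H C (⊤ : Submodule k H)) ⊓
    Submodule.comap (TensorProduct.map LinearMap.id π₀ ∘ₗ comulL k H)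
      (tensorSM k H (⊤ : Submodule k H) D)

end HopfClass

namespace HopfClass

section MatrixUnits

variable {k : Type*} [Field k] {n : ℕ} {d : Fin n → ℕ}

/-- The matrix unit with entry `1` at position `(a, b)` of the block `i`. -/
def blockUnit (i : Fin n) (a b : Fin (d i)) : Π i, Matrix (Fin (d i)) (Fin (d i)) k :=
  Pi.single i (Matrix.single a b 1)

lemma blockUnit_mul_same (i : Fin n) (a b c e : Fin (d i)) :
    (blockUnit i a b * blockUnit i c e : Π i, Matrix (Fin (d i)) (Fin (d i)) k) =
      if b = c then blockUnit i a e else 0 := by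
  unfold blockUnit
  rw [← Pi.single_mul]
  split_ifs with h
  · subst h; simp
  · rw [Matrix.single_mul_single_of_ne _ _ _ _ h, Pi.single_zero]

lemma sum_blockUnit :
    ∑ i, ∑ a, (blockUnit i a a : Π i, Matrix (Fin (d i)) (Fin (d i)) k) = 1 := by
  ext l : 1
  rw [Finset.sum_apply, Finset.sum_eq_single l]
  · rw [Finset.sum_apply]
    simp only [blockUnit, Pi.single_eq_same, Pi.one_apply]
    ext u v
    simp [Matrix.sum_apply, Matrix.single_apply, Matrix.one_apply, Finset.filter_and]
    rcases eq_or_ne u v with rfl | h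
    · simp [Finset.filter_eq']
    · simp [h, Finset.filter_eq']
  · intro j _ hj
    simp [blockUnit, Pi.single_eq_of_ne hj.symm]
  · simp

lemma blockUnit_mul (x : Π i, Matrix (Fin (d i)) (Fin (d i)) k) (i : Fin n) (a b : Fin (d i)) :
    blockUnit i a b * x = ∑ c, x i b c • blockUnit i a c := by
  ext l u v
  rw [Finset.sum_apply, Matrix.sum_apply]
  by_cases hl : l = i
  · subst hl
    simp only [blockUnit, Pi.mul_apply, Pi.single_eq_same, Pi.smul_apply, Matrix.smul_apply]
    by_cases hu : u = a
    · subst hu; simp [Matrix.single_apply]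
    · simp [Ne.symm hu, hu]
  · simp [blockUnit, Pi.single_eq_of_ne hl]

lemma blockUnit_apply_same (i : Fin n) (a b c e : Fin (d i)) :
    (blockUnit i a b : Π i, Matrix (Fin (d i)) (Fin (d i)) k) i c e =
      if a = c ∧ b = e then 1 else 0 := by
  simp [blockUnit, Matrix.single_apply]

lemma blockUnit_apply_ne {i j : Fin n} (h : j ≠ i) (a b : Fin (d i)) (c e : Fin (d j)) :
    (blockUnit i a b : Π i, Matrix (Fin (d i)) (Fin (d i)) k) j c e = 0 := by
  simp [blockUnit, Pi.single_eq_of_ne h]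

end MatrixUnits

/-- A finite-dimensional algebra over an algebraically closed field maps onto a product of matrix
algebras with nilpotent kernel. -/
lemma exists_algHom_pi_matrix (k A : Type*) [Field k] [IsAlgClosed k] [Ring A] [Algebra k A]
    [FiniteDimensional k A] :
    ∃ (n : ℕ) (d : Fin n → ℕ) (φ : A →ₐ[k] Π i, Matrix (Fin (d i)) (Fin (d i)) k),
      (∀ i, NeZero (d i)) ∧ Function.Surjective φ ∧
        ∃ N, (LinearMap.ker φ.toLinearMap) ^ N = ⊥ := by
  have : IsArtinianRing A := IsArtinianRing.of_finite k A
  obtain ⟨n, d, hd, ⟨e⟩⟩ :=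
    IsSemisimpleRing.exists_algEquiv_pi_matrix_of_isAlgClosed k (A ⧸ Ring.jacobson A)
  refine ⟨n, d, e.toAlgHom.comp (Ideal.Quotient.mkₐ k (Ring.jacobson A)), hd,
    e.surjective.comp Ideal.Quotient.mk_surjective, ?_⟩
  obtain ⟨N, hN⟩ := IsSemiprimaryRing.isNilpotent (R := A)
  refine ⟨N + 1, ?_⟩
  have hker : ∀ x, x ∈ LinearMap.ker
      (e.toAlgHom.comp (Ideal.Quotient.mkₐ k (Ring.jacobson A))).toLinearMap →
      x ∈ Ring.jacobson A := by
    intro x hx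
    simpa [Ideal.Quotient.eq_zero_iff_mem] using hx
  have key : ∀ m, (LinearMap.ker
      (e.toAlgHom.comp (Ideal.Quotient.mkₐ k (Ring.jacobson A))).toLinearMap) ^ (m + 1) ≤
      ((Ring.jacobson A) ^ (m + 1)).restrictScalars k := by
    intro m
    induction m with
    | zero =>
      intro x hx
      rw [zero_add, Submodule.pow_one]
      exact hker x (by simpa using hx)
    | succ m ih =>
      rw [pow_succ, Submodule.mul_le]
      intro x hx y hy
      rw [Submodule.restrictScalars_mem, Submodule.pow_succ (M := Ring.jacobson A)]
      exact Submodule.mul_mem_mul (ih hx) (hker y hy)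
  rw [eq_bot_iff]
  refine (key N).trans ?_
  intro x hx
  have hx' : x ∈ (Ring.jacobson A) ^ (N + 1) := hx
  rw [Submodule.pow_succ, hN] at hx'
  simpa using hx'

section Slices

variable {k : Type*} [Field k] {M N : Type*} [AddCommGroup M] [Module k M]
  [AddCommGroup N] [Module k N]

/-- Apply a functional to the left tensor factor. -/
noncomputable def sliceL (a : M →ₗ[k] k) : M ⊗[k] N →ₗ[k] N :=
  (TensorProduct.lid k N).toLinearMap ∘ₗ a.rTensor N

/-- Apply a functional to the right tensor factor. -/
noncomputable def sliceR (b : N →ₗ[k] k) : M ⊗[k] N →ₗ[k] M :=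
  (TensorProduct.rid k M).toLinearMap ∘ₗ b.lTensor M

@[simp] lemma sliceL_tmul (a : M →ₗ[k] k) (x : M) (y : N) :
    sliceL a (x ⊗ₜ[k] y) = a x • y := by simp [sliceL]

@[simp] lemma sliceR_tmul (b : N →ₗ[k] k) (x : M) (y : N) :
    sliceR b (x ⊗ₜ[k] y) = b y • x := by simp [sliceR]

lemma apply_sliceL (a : M →ₗ[k] k) (b : N →ₗ[k] k) (t : M ⊗[k] N) :
    b (sliceL a t) = a (sliceR b t) := by
  induction t with
  | zero => simp
  | tmul x y => simp [mul_comm]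
  | add x y hx hy => simp [hx, hy]

lemma ext_sliceR {t u : M ⊗[k] N} (h : ∀ b, sliceR b t = sliceR b u) : t = u := by
  apply (TensorProduct.equivFinsuppOfBasisRight (M := M) (Module.Free.chooseBasis k N)).injective
  ext i
  rw [TensorProduct.equivFinsuppOfBasisRight_apply, TensorProduct.equivFinsuppOfBasisRight_apply]
  exact h _

lemma ext_slice {t u : M ⊗[k] N}
    (h : ∀ (a : M →ₗ[k] k) (b : N →ₗ[k] k), a (sliceR b t) = a (sliceR b u)) : t = u :=
  ext_sliceR fun b => by
    rw [← sub_eq_zero]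
    exact (Module.forall_dual_apply_eq_zero_iff k _).1 fun a => by rw [map_sub, sub_eq_zero, h a b]

lemma ext_sliceL {t u : M ⊗[k] N} (h : ∀ a, sliceL a t = sliceL a u) : t = u :=
  ext_slice fun a b => by rw [← apply_sliceL, ← apply_sliceL, h a]

lemma sliceR_map {M' N' : Type*} [AddCommGroup M'] [Module k M'] [AddCommGroup N'] [Module k N']
    (f : M →ₗ[k] M') (g : N →ₗ[k] N') (b : N' →ₗ[k] k) (t : M ⊗[k] N) :
    sliceR b (TensorProduct.map f g t) = f (sliceR (b ∘ₗ g) t) := by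
  induction t with
  | zero => simp
  | tmul x y => simp
  | add x y hx hy => simp [hx, hy]

lemma sliceL_map {M' N' : Type*} [AddCommGroup M'] [Module k M'] [AddCommGroup N'] [Module k N']
    (f : M →ₗ[k] M') (g : N →ₗ[k] N') (a : M' →ₗ[k] k) (t : M ⊗[k] N) :
    sliceL a (TensorProduct.map f g t) = g (sliceL (a ∘ₗ f) t) := by
  induction t with
  | zero => simp
  | tmul x y => simp
  | add x y hx hy => simp [hx, hy]

lemma exists_projection (V : Submodule k M) :
    ∃ r : M →ₗ[k] M, (∀ x, r x ∈ V) ∧ ∀ x ∈ V, r x = x := by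
  obtain ⟨f, hf⟩ := V.subtype.exists_leftInverse_of_injective V.ker_subtype
  refine ⟨V.subtype ∘ₗ f, fun x => (f x).2, fun x hx => ?_⟩
  have := LinearMap.congr_fun hf ⟨x, hx⟩
  simpa using congrArg Subtype.val this

end Slices

section TensorSM

variable {k : Type*} [Field k] {H : Type*} [AddCommGroup H] [Module k H]

lemma mem_tensorSM_iff {A B : Submodule k H} {t : H ⊗[k] H} :
    t ∈ tensorSM k H A B ↔ (∀ b, sliceR b t ∈ A) ∧ ∀ a, sliceL a t ∈ B := by
  constructor
  · rintro ⟨u, rfl⟩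
    exact ⟨fun b => by rw [sliceR_map]; exact Submodule.coe_mem _,
      fun a => by rw [sliceL_map]; exact Submodule.coe_mem _⟩
  · rintro ⟨hA, hB⟩
    obtain ⟨r, hr, hr'⟩ := exists_projection A
    obtain ⟨s, hs, hs'⟩ := exists_projection B
    refine ⟨TensorProduct.map (r.codRestrict A hr) (s.codRestrict B hs) t, ?_⟩
    rw [← LinearMap.comp_apply, ← TensorProduct.map_comp, LinearMap.subtype_comp_codRestrict,
      LinearMap.subtype_comp_codRestrict]
    have h1 : TensorProduct.map LinearMap.id s t = t :=
      ext_sliceL fun a => by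
        rw [sliceL_map, LinearMap.comp_id, hs' _ (hB a)]
    have h2 : TensorProduct.map r LinearMap.id t = t :=
      ext_sliceR fun a => by
        rw [sliceR_map, LinearMap.comp_id, hr' _ (hA a)]
    conv_rhs => rw [← h2, ← h1]
    rw [← LinearMap.comp_apply, ← TensorProduct.map_comp, LinearMap.comp_id, LinearMap.id_comp]

lemma tmul_mem_tensorSM {A B : Submodule k H} {x y : H} (hx : x ∈ A) (hy : y ∈ B) :
    x ⊗ₜ[k] y ∈ tensorSM k H A B :=
  ⟨⟨x, hx⟩ ⊗ₜ ⟨y, hy⟩, by simp⟩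

lemma map_mem_of_mem_tensorSM {X : Type*} [AddCommGroup X] [Module k X] {V : Submodule k X}
    {A B : Submodule k H} (f : H ⊗[k] H →ₗ[k] X) (h : ∀ x ∈ A, ∀ y ∈ B, f (x ⊗ₜ[k] y) ∈ V)
    {t : H ⊗[k] H} (ht : t ∈ tensorSM k H A B) : f t ∈ V := by
  obtain ⟨u, rfl⟩ := ht
  induction u with
  | zero => simp
  | tmul x y => simpa using h x x.2 y y.2
  | add x y hx hy => rw [map_add, map_add]; exact V.add_mem hx hy

lemma finrank_tensorSM [FiniteDimensional k H] (A B : Submodule k H) :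
    Module.finrank k (tensorSM k H A B) = Module.finrank k A * Module.finrank k B := by
  rw [tensorSM, LinearMap.finrank_range_of_inj, Module.finrank_tensorProduct]
  exact TensorProduct.map_injective_of_flat_flat _ _ A.subtype_injective B.subtype_injective

end TensorSM

section Hit

open WithConv

lemma ext_conv {k : Type*} [Field k] {H : Type*} [AddCommGroup H] [Module k H] {x y : H}
    (h : ∀ a : WithConv (H →ₗ[k] k), a x = a y) : x = y := by
  rw [← sub_eq_zero]
  refine (Module.forall_dual_apply_eq_zero_iff k _).1 fun a => ?_
  rw [map_sub, sub_eq_zero]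
  exact h (toConv a)

variable {k : Type*} [Field k] {H : Type*} [AddCommGroup H] [Module k H] [Coalgebra k H]

/-- The left action `x ↦ a(x₁) x₂` of a functional. -/
noncomputable def hitL (a : WithConv (H →ₗ[k] k)) : H →ₗ[k] H :=
  sliceL a.ofConv ∘ₗ Coalgebra.comul

/-- The right action `x ↦ x₁ b(x₂)` of a functional. -/
noncomputable def hitR (b : WithConv (H →ₗ[k] k)) : H →ₗ[k] H :=
  sliceR b.ofConv ∘ₗ Coalgebra.comul

lemma conv_apply_eq_hitR (a b : WithConv (H →ₗ[k] k)) (x : H) : (a * b) x = a (hitR b x) := by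
  rw [LinearMap.convMul_apply, hitR, LinearMap.comp_apply]
  induction Coalgebra.comul (R := k) x with
  | zero => simp
  | tmul x y => simp [mul_comm]
  | add x y hx hy => simp only [map_add, hx, hy]

lemma conv_apply_eq_hitL (a b : WithConv (H →ₗ[k] k)) (x : H) : (a * b) x = b (hitL a x) := by
  rw [conv_apply_eq_hitR]
  exact (apply_sliceL _ _ _).symm

lemma hitR_mul (a b : WithConv (H →ₗ[k] k)) (x : H) : hitR (a * b) x = hitR a (hitR b x) :=
  ext_conv fun c => by rw [← conv_apply_eq_hitR, ← conv_apply_eq_hitR, ← conv_apply_eq_hitR,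
    mul_assoc]

lemma hitL_mul (a b : WithConv (H →ₗ[k] k)) (x : H) : hitL (a * b) x = hitL b (hitL a x) :=
  ext_conv fun c => by rw [← conv_apply_eq_hitL, ← conv_apply_eq_hitL, ← conv_apply_eq_hitL,
    mul_assoc]

lemma hitL_hitR (a b : WithConv (H →ₗ[k] k)) (x : H) : hitL a (hitR b x) = hitR b (hitL a x) :=
  ext_conv fun c => by rw [← conv_apply_eq_hitL, ← conv_apply_eq_hitR, ← conv_apply_eq_hitR,
    ← conv_apply_eq_hitL, mul_assoc]

lemma hitL_one (x : H) : hitL (1 : WithConv (H →ₗ[k] k)) x = x :=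
  ext_conv fun c => by rw [← conv_apply_eq_hitL, one_mul]

lemma hitR_one (x : H) : hitR (1 : WithConv (H →ₗ[k] k)) x = x :=
  ext_conv fun c => by rw [← conv_apply_eq_hitR, mul_one]

end Hit

section Hopf

open WithConv Coalgebra HopfAlgebra

variable {k : Type*} [Field k] {H : Type*} [Ring H] [HopfAlgebra k H]

lemma conv_algHom_antipode {X : Type*} [Ring X] [Algebra k X] (f : H →ₐ[k] X) :
    toConv f.toLinearMap * toConv (f.toLinearMap ∘ₗ antipode k) = 1 := by
  ext x
  rw [(ℛ k x).convMul_apply]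
  simp [← map_mul, ← map_sum, sum_mul_antipode_eq_algebraMap_counit]

lemma conv_antipode_algHom {X : Type*} [Ring X] [Algebra k X] (f : H →ₐ[k] X) :
    toConv (f.toLinearMap ∘ₗ antipode k) * toConv f.toLinearMap = 1 := by
  ext x
  rw [(ℛ k x).convMul_apply]
  simp [← map_mul, ← map_sum, sum_antipode_mul_eq_algebraMap_counit]

variable (k H) in
/-- The embedding `x ↦ x ⊗ 1`. -/
noncomputable abbrev inclL : H →ₐ[k] H ⊗[k] H := Algebra.TensorProduct.includeLeft

variable (k H) in
/-- The embedding `x ↦ 1 ⊗ x`. -/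
noncomputable abbrev inclR : H →ₐ[k] H ⊗[k] H := Algebra.TensorProduct.includeRight

lemma conv_inclL_inclR :
    toConv (inclL k H).toLinearMap * toConv (inclR k H).toLinearMap =
      toConv (comul : H →ₗ[k] H ⊗[k] H) := by
  ext x
  rw [(ℛ k x).convMul_apply]
  simp [(ℛ k x).eq]

/-- The antipode reverses comultiplication. -/
lemma comul_comp_antipode :
    (comul : H →ₗ[k] H ⊗[k] H) ∘ₗ antipode k =
      (toConv ((inclR k H).toLinearMap ∘ₗ antipode k) *
        toConv ((inclL k H).toLinearMap ∘ₗ antipode k)).ofConv := by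
  apply toConv_injective
  refine left_inv_eq_right_inv (a := toConv (comul : H →ₗ[k] H ⊗[k] H)) ?_ ?_
  · exact conv_antipode_algHom (Bialgebra.comulAlgHom k H)
  · rw [toConv_ofConv, ← conv_inclL_inclR, mul_assoc, ← mul_assoc (toConv (inclR k H).toLinearMap),
      conv_algHom_antipode, one_mul, conv_algHom_antipode]

lemma conv_comp_antipode (a b : WithConv (H →ₗ[k] k)) :
    toConv ((a * b).ofConv ∘ₗ antipode k) =
      toConv (b.ofConv ∘ₗ antipode k) * toConv (a.ofConv ∘ₗ antipode k) := by
  ext x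
  rw [(ℛ k x).convMul_apply]
  have h := LinearMap.congr_fun (comul_comp_antipode (k := k) (H := H)) x
  have h2 := (ℛ k x).convMul_apply (toConv ((inclR k H).toLinearMap ∘ₗ antipode k))
    (toConv ((inclL k H).toLinearMap ∘ₗ antipode k))
  change _ = (_ : WithConv (H →ₗ[k] H ⊗[k] H)) x at h
  rw [h2] at h
  change (a * b) (antipode k x) = _
  rw [LinearMap.convMul_apply]
  change LinearMap.mul' k k (TensorProduct.map a.ofConv b.ofConv
    ((comul ∘ₗ antipode k) x)) = _
  rw [h]
  simp [mul_comm]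

end Hopf

section Twist

open WithConv Coalgebra HopfAlgebra

variable {k : Type*} [Field k] {H : Type*} [Ring H] [HopfAlgebra k H]

variable (k H) in
/-- The map `x ⊗ u ↦ x₁ ⊗ x₂ u`. -/
noncomputable def twist : H ⊗[k] H →ₗ[k] H ⊗[k] H :=
  TensorProduct.lift ((LinearMap.mul k (H ⊗[k] H)).compl₁₂ comul (inclR k H).toLinearMap)

variable (k H) in
/-- The map `x ⊗ u ↦ x₁ ⊗ S(x₂) u`. -/
noncomputable def untwist : H ⊗[k] H →ₗ[k] H ⊗[k] H :=
  TensorProduct.lift ((LinearMap.mul k (H ⊗[k] H)).compl₁₂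
    ((antipode k).lTensor H ∘ₗ comul) (inclR k H).toLinearMap)

lemma twist_tmul (x u : H) : twist k H (x ⊗ₜ[k] u) = comul (R := k) x * (1 ⊗ₜ[k] u) := by
  simp [twist]

lemma untwist_tmul (x u : H) :
    untwist k H (x ⊗ₜ[k] u) = (antipode k).lTensor H (comul (R := k) x) * (1 ⊗ₜ[k] u) := by
  simp [untwist]

lemma twist_mul_one_tmul (t : H ⊗[k] H) (u : H) :
    twist k H (t * (1 ⊗ₜ[k] u)) = twist k H t * (1 ⊗ₜ[k] u) := by
  induction t with
  | zero => simp
  | tmul x y => simp [twist_tmul, mul_assoc]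
  | add x y hx hy => rw [add_mul, map_add, hx, hy, map_add, add_mul]

lemma twist_tmul_one_mul (b : H) (t : H ⊗[k] H) :
    twist k H ((b ⊗ₜ[k] 1) * t) = comul (R := k) b * twist k H t := by
  induction t with
  | zero => simp
  | tmul x y => simp [twist_tmul, mul_assoc]
  | add x y hx hy => rw [mul_add, map_add, hx, hy, map_add, mul_add]

lemma twist_lTensor_antipode_comul (x : H) :
    twist k H ((antipode k).lTensor H (comul (R := k) x)) = x ⊗ₜ[k] 1 := by
  have h : toConv (comul : H →ₗ[k] H ⊗[k] H) *
      toConv ((inclR k H).toLinearMap ∘ₗ antipode k) = toConv (inclL k H).toLinearMap := by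
    rw [← conv_inclL_inclR, mul_assoc, conv_algHom_antipode, mul_one]
  have h' := congrArg (fun f : WithConv (H →ₗ[k] H ⊗[k] H) => f x) h
  simp only [(ℛ k x).convMul_apply] at h'
  rw [← (ℛ k x).eq]
  simpa [twist_tmul] using h'

lemma twist_untwist (t : H ⊗[k] H) : twist k H (untwist k H t) = t := by
  induction t with
  | zero => simp
  | tmul x u => rw [untwist_tmul, twist_mul_one_tmul, twist_lTensor_antipode_comul]; simp
  | add x y hx hy => rw [map_add, map_add, hx, hy]

lemma untwist_twist [FiniteDimensional k H] (t : H ⊗[k] H) :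
    untwist k H (twist k H t) = t := by
  have h : twist k H ∘ₗ untwist k H = LinearMap.id := LinearMap.ext twist_untwist
  exact LinearMap.congr_fun ((LinearMap.comp_eq_id_comm k _).1 h) t

variable (k H) in
/-- The map `b ⊗ x ↦ b x₁ ⊗ x₂`. -/
noncomputable def cotwist : H ⊗[k] H →ₗ[k] H ⊗[k] H :=
  TensorProduct.lift ((LinearMap.mul k (H ⊗[k] H)).compl₁₂ (inclL k H).toLinearMap comul)

variable (k H) in
/-- The map `b ⊗ x ↦ b S(x₁) ⊗ x₂`. -/
noncomputable def uncotwist : H ⊗[k] H →ₗ[k] H ⊗[k] H :=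
  TensorProduct.lift ((LinearMap.mul k (H ⊗[k] H)).compl₁₂ (inclL k H).toLinearMap
    ((antipode k).rTensor H ∘ₗ comul))

lemma cotwist_tmul (b x : H) : cotwist k H (b ⊗ₜ[k] x) = (b ⊗ₜ[k] 1) * comul (R := k) x := by
  simp [cotwist]

lemma uncotwist_tmul (b x : H) :
    uncotwist k H (b ⊗ₜ[k] x) = (b ⊗ₜ[k] 1) * (antipode k).rTensor H (comul (R := k) x) := by
  simp [uncotwist]

lemma uncotwist_tmul_one_mul (b : H) (t : H ⊗[k] H) :
    uncotwist k H ((b ⊗ₜ[k] 1) * t) = (b ⊗ₜ[k] 1) * uncotwist k H t := by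
  induction t with
  | zero => simp
  | tmul x y => simp [uncotwist_tmul, ← mul_assoc]
  | add x y hx hy => rw [mul_add, map_add, hx, hy, map_add, mul_add]

lemma uncotwist_comul (x : H) : uncotwist k H (comul (R := k) x) = 1 ⊗ₜ[k] x := by
  have h2 : toConv ((inclL k H).toLinearMap ∘ₗ antipode k) * toConv (inclR k H).toLinearMap =
      toConv ((antipode k).rTensor H ∘ₗ comul) := by
    ext y
    rw [(ℛ k y).convMul_apply]
    simp [← (ℛ k y).eq]
  have h : toConv (inclL k H).toLinearMap * toConv ((antipode k).rTensor H ∘ₗ comul) =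
      toConv (inclR k H).toLinearMap := by
    rw [← h2, ← mul_assoc, conv_algHom_antipode, one_mul]
  have h' := congrArg (fun f : WithConv (H →ₗ[k] H ⊗[k] H) => f x) h
  simp only [(ℛ k x).convMul_apply] at h'
  rw [← (ℛ k x).eq]
  simpa [uncotwist_tmul] using h'

lemma uncotwist_cotwist (t : H ⊗[k] H) : uncotwist k H (cotwist k H t) = t := by
  induction t with
  | zero => simp
  | tmul b x => rw [cotwist_tmul, uncotwist_tmul_one_mul, uncotwist_comul]; simp
  | add x y hx hy => rw [map_add, map_add, hx, hy]

/-- An injective endomorphism mapping a subspace into one of the same dimension hits all of it. -/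
lemma exists_apply_eq_of_finrank_eq {M : Type*} [AddCommGroup M] [Module k M]
    [FiniteDimensional k M] {f : M →ₗ[k] M} (hf : Function.Injective f) {V W : Submodule k M}
    (h : ∀ v ∈ V, f v ∈ W) (hd : Module.finrank k V = Module.finrank k W) {w : M} (hw : w ∈ W) :
    ∃ v ∈ V, f v = w := by
  have h1 : V.map f = W := Submodule.eq_of_le_of_finrank_eq (by rintro _ ⟨v, hv, rfl⟩; exact h v hv)
    (by rw [← hd]; exact (Submodule.equivMapOfInjective f hf V).finrank_eq.symm)
  rw [← h1] at hw
  exact hw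

/-- A proper left ideal `P` of a finite-dimensional sub-bialgebra `B` contains no nonzero
element all of whose translates by antipodes of functionals lie in `P`. -/
lemma eq_zero_of_forall_hitR_antipode_mem [FiniteDimensional k H] {B P : Submodule k H}
    (hB : ∀ x ∈ B, comul (R := k) x ∈ tensorSM k H B B) (h1B : (1 : H) ∈ B) (hPB : P ≤ B)
    (hP : ∀ b ∈ B, ∀ x ∈ P, b * x ∈ P) (h1 : (1 : H) ∉ P) {z : H}
    (hz : ∀ c : WithConv (H →ₗ[k] k), hitR (toConv (c.ofConv ∘ₗ antipode k)) z ∈ P) : z = 0 := by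
  let N : Submodule k H :=
    { carrier := {z | ∀ c : WithConv (H →ₗ[k] k), hitR (toConv (c.ofConv ∘ₗ antipode k)) z ∈ P}
      add_mem' := fun ha hb c => by rw [map_add]; exact P.add_mem (ha c) (hb c)
      zero_mem' := fun c => by rw [map_zero]; exact P.zero_mem
      smul_mem' := fun r x hx c => by rw [map_smul]; exact P.smul_mem _ (hx c) }
  have hNP : N ≤ P := fun x hx => by
    have := hx 1
    rwa [show toConv ((1 : WithConv (H →ₗ[k] k)).ofConv ∘ₗ antipode k) =
      (1 : WithConv (H →ₗ[k] k)) by ext; simp, hitR_one] at this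
  have hhit : ∀ x ∈ N, ∀ c : WithConv (H →ₗ[k] k),
      hitR (toConv (c.ofConv ∘ₗ antipode k)) x ∈ N := fun x hx c e => by
    rw [← hitR_mul, ← conv_comp_antipode]
    exact hx _
  have hmul : ∀ b ∈ B, ∀ x ∈ N, b * x ∈ N := by
    intro b hb x hx c
    have key : ∀ t ∈ tensorSM k H B B, sliceR (c.ofConv ∘ₗ antipode k)
        (t * comul (R := k) x) ∈ P := by
      intro t ht
      refine map_mem_of_mem_tensorSM (sliceR (c.ofConv ∘ₗ antipode k) ∘ₗ
        LinearMap.mulRight k (comul (R := k) x)) ?_ ht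
      · intro y hy w hw
        have : sliceR (c.ofConv ∘ₗ antipode k) (y ⊗ₜ[k] w * comul (R := k) x) =
            y * hitR (toConv ((c.ofConv ∘ₗ LinearMap.mulRight k (antipode k w)) ∘ₗ antipode k))
              x := by
          rw [hitR, LinearMap.comp_apply]
          induction comul (R := k) x with
          | zero => simp
          | tmul u v => simp [antipode_mul_antidistrib]
          | add u v hu hv => simp only [mul_add, map_add, hu, hv]
        rw [LinearMap.comp_apply, LinearMap.mulRight_apply, this]
        exact hP y hy _ (hx (toConv _))
    have := key _ (hB b hb)
    rwa [← Bialgebra.comul_mul] at this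
  have hunt : ∀ x ∈ N, (antipode k).lTensor H (comul (R := k) x) ∈ tensorSM k H N ⊤ :=
    fun x hx => mem_tensorSM_iff.2 ⟨fun c => by
      rw [LinearMap.lTensor, sliceR_map]
      exact hhit x hx (toConv c), fun _ => Submodule.mem_top⟩
  have huntwist : ∀ t ∈ tensorSM k H N ⊤, untwist k H t ∈ tensorSM k H N ⊤ := by
    intro t ht
    refine map_mem_of_mem_tensorSM _ (fun x hx u _ => ?_) ht
    rw [untwist_tmul]
    refine map_mem_of_mem_tensorSM (LinearMap.mulRight k (1 ⊗ₜ[k] u)) (fun a ha b _ => ?_)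
      (hunt x hx)
    rw [LinearMap.mulRight_apply, Algebra.TensorProduct.tmul_mul_tmul, mul_one]
    exact tmul_mem_tensorSM ha Submodule.mem_top
  have hcomul : ∀ x ∈ N, comul (R := k) x ∈ tensorSM k H N B := by
    intro x hx
    have h2 : comul (R := k) x ∈ tensorSM k H N ⊤ := by
      obtain ⟨t, ht, ht'⟩ := exists_apply_eq_of_finrank_eq
        (Function.LeftInverse.injective (g := twist k H) twist_untwist) huntwist rfl
        (tmul_mem_tensorSM hx (Submodule.mem_top (x := 1)))
      have := congrArg (twist k H) ht'
      rw [twist_untwist, twist_tmul, ← Algebra.TensorProduct.one_def, mul_one] at this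
      rwa [← this]
    exact mem_tensorSM_iff.2 ⟨(mem_tensorSM_iff.1 h2).1,
      (mem_tensorSM_iff.1 (hB x (hPB (hNP hx)))).2⟩
  have hcotwist : ∀ t ∈ tensorSM k H B N, cotwist k H t ∈ tensorSM k H N B := by
    intro t ht
    refine map_mem_of_mem_tensorSM _ (fun b hb x hx => ?_) ht
    rw [cotwist_tmul]
    refine map_mem_of_mem_tensorSM (LinearMap.mulLeft k (b ⊗ₜ[k] 1)) (fun a ha c hc => ?_)
      (hcomul x hx)
    rw [LinearMap.mulLeft_apply, Algebra.TensorProduct.tmul_mul_tmul, one_mul]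
    exact tmul_mem_tensorSM (hmul b hb a ha) hc
  by_contra hz0
  obtain ⟨t, ht, ht'⟩ := exists_apply_eq_of_finrank_eq
    (Function.LeftInverse.injective (g := uncotwist k H) uncotwist_cotwist) hcotwist
    (by rw [finrank_tensorSM, finrank_tensorSM, mul_comm])
    (tmul_mem_tensorSM (show z ∈ N from hz) h1B)
  have h2 := congrArg (uncotwist k H) ht'
  rw [uncotwist_cotwist, uncotwist_tmul, Bialgebra.comul_one, Algebra.TensorProduct.one_def,
    LinearMap.rTensor_tmul, antipode_one, ← Algebra.TensorProduct.one_def, mul_one] at h2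
  obtain ⟨a, ha⟩ : ∃ a : H →ₗ[k] k, a z ≠ 0 := by
    by_contra! hcon
    exact hz0 ((Module.forall_dual_apply_eq_zero_iff k _).1 hcon)
  rw [h2] at ht
  have h3 := (mem_tensorSM_iff.1 ht).2 a
  rw [sliceL_tmul] at h3
  exact h1 (hNP ((Submodule.smul_mem_iff _ ha).1 h3))

end Twist

section MatrixUnits

variable {k : Type*} [Field k] {M : Type*} [AddCommGroup M] [Module k M]
  [FiniteDimensional k M]

lemma finrank_range_sum_matrixUnit {d : ℕ} (E : Fin d → Fin d → M →ₗ[k] M)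
    (hE : ∀ a b c e x, E a b (E c e x) = if b = c then E a e x else 0) (o : Fin d) :
    Module.finrank k (LinearMap.range (∑ a, E a a)) =
      d * Module.finrank k (LinearMap.range (E o o)) := by
  let f : LinearMap.range (∑ a, E a a) →ₗ[k] (Fin d → LinearMap.range (E o o)) :=
    LinearMap.pi fun a => (E o a ∘ₗ Submodule.subtype _).codRestrict _
      fun x => ⟨E o a x, by simp [hE]⟩
  let g : (Fin d → LinearMap.range (E o o)) →ₗ[k] LinearMap.range (∑ a, E a a) :=
    (∑ a, E a o ∘ₗ Submodule.subtype _ ∘ₗ LinearMap.proj a).codRestrict _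
      fun y => ⟨∑ a, E a o (y a), by simp [hE]⟩
  have hfix : ∀ x ∈ LinearMap.range (E o o), E o o x = x := by
    rintro _ ⟨x, rfl⟩
    simp [hE]
  have e : LinearMap.range (∑ a, E a a) ≃ₗ[k] (Fin d → LinearMap.range (E o o)) := by
    refine LinearEquiv.ofLinearMap f g ?_ ?_
    · refine LinearMap.ext fun y => funext fun b => Subtype.ext ?_
      change E o b ((∑ a, E a o ∘ₗ Submodule.subtype _ ∘ₗ LinearMap.proj a) y) = y b
      simp [hE, hfix]
    · refine LinearMap.ext fun x => Subtype.ext ?_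
      change (∑ a, E a o ∘ₗ Submodule.subtype _ ∘ₗ LinearMap.proj a) (f x) = x
      have hf : ∀ a, (f x a : M) = E o a x := fun _ => rfl
      simp only [LinearMap.sum_apply, LinearMap.comp_apply, LinearMap.proj_apply,
        Submodule.subtype_apply, hf]
      obtain ⟨_, x, rfl⟩ := x
      simp [hE]
  rw [e.finrank_eq, Module.finrank_pi_fintype]
  simp

lemma exists_generators_of_matrixUnit {d t : ℕ} [NeZero d]
    (E : Fin d → Fin d → M →ₗ[k] M)
    (hE : ∀ a b c e x, E a b (E c e x) = if b = c then E a e x else 0)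
    (h1 : ∀ x, ∑ a, E a a x = x) (ht : Module.finrank k M ≤ t * d ^ 2) :
    ∃ w : Fin t → M, ∀ v, ∃ c : Fin t → Fin d → Fin d → k,
      v = ∑ s, ∑ a, ∑ b, c s a b • E a b (w s) := by
  have hr := finrank_range_sum_matrixUnit E hE 0
  rw [show ∑ a, E a a = LinearMap.id by ext x; simp [h1], LinearMap.range_id, finrank_top] at hr
  have hd : 0 < d := Nat.pos_of_ne_zero (NeZero.ne d)
  have hle : Module.finrank k (LinearMap.range (E 0 0)) ≤ t * d := by
    refine Nat.le_of_mul_le_mul_left ?_ hd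
    rw [← hr]
    exact ht.trans (by ring_nf; rfl)
  obtain ⟨f, hf⟩ : ∃ f : (Fin t × Fin d → k) →ₗ[k] LinearMap.range (E 0 0),
      Function.Surjective f := by
    let e := LinearEquiv.ofFinrankEq (Fin (Module.finrank k (LinearMap.range (E 0 0))) → k)
      (LinearMap.range (E 0 0)) (Module.finrank_fin_fun k)
    exact ⟨e.toLinearMap ∘ₗ LinearMap.funLeft k k (finProdFinEquiv.symm ∘ Fin.castLE hle),
      e.surjective.comp (LinearMap.funLeft_surjective_of_injective _ _ _
        (finProdFinEquiv.symm.injective.comp (Fin.castLE_injective hle)))⟩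
  have hfix : ∀ x ∈ LinearMap.range (E 0 0), E 0 0 x = x := by
    rintro _ ⟨x, rfl⟩
    simp [hE]
  refine ⟨fun s => ∑ j, E j 0 (f (Pi.single (s, j) 1)), fun v => ?_⟩
  choose c hc using fun a => hf ⟨E 0 a v, E 0 a v, by simp [hE]⟩
  refine ⟨fun s a b => c a (s, b), ?_⟩
  have key : ∀ a, E 0 a v = ∑ s, ∑ b, c a (s, b) • (f (Pi.single (s, b) 1) : M) := by
    intro a
    have h2 : (f (c a) : M) = E 0 a v := congrArg Subtype.val (hc a)
    conv_lhs at h2 => rw [pi_eq_sum_univ' (c a)]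
    rw [← h2, ← Fintype.sum_prod_type']
    simp
  conv_lhs => rw [← h1 v]
  rw [Finset.sum_comm]
  refine Finset.sum_congr rfl fun a _ => ?_
  have : E a a v = E a 0 (E 0 a v) := by simp [hE]
  rw [this, key]
  simp [hE]

end MatrixUnits

section Generators

variable {k : Type*} [Field k] {B W : Type*} [Ring B] [Algebra k B] [AddCommGroup W] [Module k W]
  [Module B W] [IsScalarTower k B W]

lemma eq_top_of_nilpotent_smul {J : Submodule k B} {N : ℕ} (hN : J ^ N = ⊥)
    (S : Submodule B W)
    (h : ∀ w, w ∈ S.restrictScalars k ⊔ Submodule.span k {x | ∃ b ∈ J, ∃ y : W, x = b • y}) :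
    S = ⊤ := by
  have key : ∀ n w, w ∈ S.restrictScalars k ⊔
      Submodule.span k {x | ∃ b ∈ J ^ n, ∃ y : W, x = b • y} := by
    intro n
    induction n with
    | zero =>
      exact fun w => Submodule.mem_sup_right (Submodule.subset_span
        ⟨1, by rw [pow_zero]; exact Submodule.one_le.1 le_rfl, w, (one_smul B w).symm⟩)
    | succ n ih =>
      intro w
      refine SetLike.le_def.1 (sup_le le_sup_left (Submodule.span_le.2 ?_)) (ih w)
      rintro _ ⟨b, hb, y, rfl⟩
      obtain ⟨s, hs, x, hx, rfl⟩ := Submodule.mem_sup.1 (h y)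
      rw [smul_add]
      refine add_mem (Submodule.mem_sup_left (S.smul_mem b hs)) (Submodule.mem_sup_right ?_)
      have : Submodule.span k {x | ∃ b ∈ J, ∃ y : W, x = b • y} ≤
          (Submodule.span k {x | ∃ b ∈ J ^ (n + 1), ∃ y : W, x = b • y}).comap
            (Algebra.lsmul k k W b) := by
        refine Submodule.span_le.2 ?_
        rintro _ ⟨c, hc, z, rfl⟩
        refine Submodule.subset_span ⟨b * c, ?_, z, by simp [mul_smul]⟩
        rw [pow_succ]
        exact Submodule.mul_mem_mul hb hc
      exact this hx
  refine eq_top_iff.2 fun w _ => ?_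
  have h2 := key N w
  rw [hN] at h2
  refine SetLike.le_def.1 (sup_le (le_refl (S.restrictScalars k)) (Submodule.span_le.2 ?_)) h2
  rintro _ ⟨b, hb, y, rfl⟩
  rw [(Submodule.mem_bot k).1 hb, zero_smul]
  exact S.zero_mem

lemma exists_generators_of_finrank_quotient_le [FiniteDimensional k W] {n : ℕ} {d : Fin n → ℕ}
    [∀ i, NeZero (d i)] (φ : B →ₐ[k] Π i, Matrix (Fin (d i)) (Fin (d i)) k)
    (hφ : Function.Surjective φ) {N : ℕ} (hN : (LinearMap.ker φ.toLinearMap) ^ N = ⊥)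
    (V : Fin n → Submodule k W) (hV : ∀ i b w, φ b i = 0 → b • w ∈ V i)
    (hV' : ∀ i, V i ≤ Submodule.span k {x | ∃ b : B, φ b i = 0 ∧ ∃ w : W, x = b • w}) {t : ℕ}
    (ht : ∀ i, Module.finrank k (W ⧸ V i) ≤ t * d i ^ 2) :
    ∃ w : Fin t → W, ∀ v, ∃ c : Fin t → B, v = ∑ s, c s • w s := by
  choose u hu using fun i a b => hφ (blockUnit (d := d) (k := k) i a b)
  have hstable : ∀ i (b : B), V i ≤ (V i).comap (Algebra.lsmul k k W b) := by
    intro i b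
    refine (hV' i).trans (Submodule.span_le.2 ?_)
    rintro _ ⟨c, hc, w, rfl⟩
    have := hV i (b * c) w (by simp [hc])
    simpa [mul_smul] using this
  have hblock : ∀ i, ∃ w : Fin t → W, ∀ v, ∃ c : Fin t → Fin (d i) → Fin (d i) → k,
      v - (∑ s, ∑ a, ∑ b, c s a b • u i a b • w s) ∈ V i := by
    intro i
    obtain ⟨w, hw⟩ := exists_generators_of_matrixUnit (t := t)
      (fun a b => (V i).mapQ (V i) (Algebra.lsmul k k W (u i a b)) (hstable i _))
      (by
        intro a b c e x
        obtain ⟨x, rfl⟩ := (V i).mkQ_surjective x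
        have h2 : ∀ y : B, φ y i = 0 → (V i).mkQ (y • x) = 0 := fun y hy => by
          simpa using hV i y x hy
        have h3 := h2 (u i a b * u i c e - if b = c then u i a e else 0) (by
          rw [map_sub, map_mul, hu, hu, blockUnit_mul_same, apply_ite φ, hu, map_zero, sub_self]
          rfl)
        rw [sub_smul, map_sub, sub_eq_zero, ite_smul, zero_smul, mul_smul, apply_ite (V i).mkQ,
          map_zero] at h3
        simpa using h3)
      (by
        intro x
        obtain ⟨x, rfl⟩ := (V i).mkQ_surjective x
        have h3 : (V i).mkQ ((∑ a, u i a a - 1) • x) = 0 := by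
          have := hV i (∑ a, u i a a - 1) x (by
            rw [map_sub, map_sum, Pi.sub_apply, Finset.sum_apply, sub_eq_zero]
            simp only [hu]
            ext b c
            rw [Matrix.sum_apply]
            simp [blockUnit_apply_same, Matrix.one_apply, ite_and])
          simpa using this
        rw [sub_smul, map_sub, sub_eq_zero, one_smul, Finset.sum_smul, map_sum] at h3
        simpa using h3)
      (ht i)
    choose w' hw' using fun s => (V i).mkQ_surjective (w s)
    refine ⟨w', fun v => ?_⟩
    obtain ⟨c, hc⟩ := hw ((V i).mkQ v)
    refine ⟨c, ?_⟩
    rw [← Submodule.ker_mkQ (V i), LinearMap.mem_ker, map_sub, sub_eq_zero, hc]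
    simp [← hw']
  choose w hw using hblock
  choose e he using fun i => hφ (Pi.single i 1)
  refine ⟨fun s => ∑ i, e i • w i s, ?_⟩
  set S := Submodule.span B (Set.range fun s => ∑ i, e i • w i s) with hS
  suffices S = ⊤ by
    intro v
    obtain ⟨c, hc⟩ := (Submodule.mem_span_range_iff_exists_fun B).1
      (this ▸ Submodule.mem_top : v ∈ S)
    exact ⟨c, hc.symm⟩
  refine eq_top_of_nilpotent_smul hN S fun v => ?_
  set JW := Submodule.span k {x | ∃ b ∈ LinearMap.ker φ.toLinearMap, ∃ y : W, x = b • y}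
  have hJ : ∀ b (y : W), φ b = 0 → b • y ∈ S.restrictScalars k ⊔ JW := fun b y hb =>
    Submodule.mem_sup_right (Submodule.subset_span ⟨b, hb, y, rfl⟩)
  have hblock : ∀ i, e i • v ∈ S.restrictScalars k ⊔ JW := by
    intro i
    obtain ⟨c, hc⟩ := hw i v
    have h1 : e i • (v - ∑ s, ∑ a, ∑ b, c s a b • u i a b • w i s) ∈
        S.restrictScalars k ⊔ JW := by
      have : V i ≤ (S.restrictScalars k ⊔ JW).comap (Algebra.lsmul k k W (e i)) := by
        refine (hV' i).trans (Submodule.span_le.2 ?_)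
        rintro _ ⟨b, hb, y, rfl⟩
        have := hJ (e i * b) y (by
          rw [map_mul, he]
          ext j
          obtain rfl | hj := eq_or_ne j i
          · simp [hb]
          · simp [Pi.single_eq_of_ne hj])
        simpa [mul_smul] using this
      exact this hc
    have h2 : ∀ s a b, e i • u i a b • w i s ∈ S.restrictScalars k ⊔ JW := by
      intro s a b
      have h3 : u i a b • ∑ j, e j • w j s ∈ S.restrictScalars k ⊔ JW :=
        Submodule.mem_sup_left (S.smul_mem _ (Submodule.subset_span ⟨s, rfl⟩))
      have h4 : u i a b • ∑ j, e j • w j s - e i • u i a b • w i s =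
          (u i a b * e i - e i * u i a b) • w i s +
          ∑ j ∈ Finset.univ.erase i, (u i a b * e j) • w j s := by
        rw [← Finset.add_sum_erase _ _ (Finset.mem_univ i), smul_add, Finset.smul_sum]
        simp only [sub_smul, mul_smul]
        abel
      have h5 : u i a b • ∑ j, e j • w j s - e i • u i a b • w i s ∈
          S.restrictScalars k ⊔ JW := by
        rw [h4]
        refine add_mem (hJ _ _ ?_) (sum_mem fun j hj => hJ _ _ ?_)
        · rw [map_sub, map_mul, map_mul, hu, he]
          ext j
          obtain rfl | hj := eq_or_ne j i
          · simp
          · simp [Pi.single_eq_of_ne hj]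
        · rw [map_mul, hu, he]
          ext l b c
          obtain rfl | hl := eq_or_ne l i
          · simp [Pi.single_eq_of_ne (Finset.ne_of_mem_erase hj).symm]
          · simp [Matrix.mul_apply, blockUnit_apply_ne hl]
      have := sub_mem h3 h5
      rwa [sub_sub_cancel] at this
    have h6 : e i • v = e i • (v - ∑ s, ∑ a, ∑ b, c s a b • u i a b • w i s) +
        ∑ s, ∑ a, ∑ b, c s a b • e i • u i a b • w i s := by
      rw [smul_sub]
      simp only [Finset.smul_sum, smul_comm (e i) (_ : k)]
      abel
    rw [h6]
    exact add_mem h1 (sum_mem fun s _ => sum_mem fun a _ => sum_mem fun b _ =>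
      Submodule.smul_mem _ _ (h2 s a b))
  have h7 : v = ∑ i, e i • v + (1 - ∑ i, e i) • v := by
    rw [sub_smul, Finset.sum_smul, one_smul]
    abel
  rw [h7]
  refine add_mem (sum_mem fun i _ => hblock i) (hJ _ _ ?_)
  rw [map_sub, map_one, map_sum, sub_eq_zero]
  simp only [he]
  exact (Finset.univ_sum_single (1 : Π i, Matrix (Fin (d i)) (Fin (d i)) k)).symm

end Generators

section Freeness

open WithConv Coalgebra HopfAlgebra

variable {k : Type*} [Field k]

lemma ker_le_ker_of_finrank_eq {U X Y : Type*} [AddCommGroup U] [Module k U]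
    [FiniteDimensional k U] [AddCommGroup X] [Module k X] [AddCommGroup Y] [Module k Y]
    {f : U →ₗ[k] X} {g : U →ₗ[k] Y} (hf : Function.Surjective f) (hg : Function.Surjective g)
    (h : LinearMap.ker f ≤ LinearMap.ker g) (hd : Module.finrank k X = Module.finrank k Y) :
    LinearMap.ker g ≤ LinearMap.ker f := by
  refine (Submodule.eq_of_le_of_finrank_le h ?_).ge
  have h1 := f.finrank_range_add_finrank_ker
  have h2 := g.finrank_range_add_finrank_ker
  rw [LinearMap.range_eq_top.2 hf, finrank_top] at h1
  rw [LinearMap.range_eq_top.2 hg, finrank_top] at h2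
  omega

variable {H : Type*} [Ring H] [HopfAlgebra k H] [FiniteDimensional k H] {B : Subalgebra k H}

lemma eq_zero_of_sum_mul_eq_zero
    (hB : ∀ x ∈ B, comul (R := k) x ∈ tensorSM k H (Subalgebra.toSubmodule B)
      (Subalgebra.toSubmodule B))
    {d : ℕ} [NeZero d] (φ : B →ₐ[k] Matrix (Fin d) (Fin d) k) (hφ : Function.Surjective φ)
    {t l : ℕ} (w : Fin t → Fin l → H)
    (hw : ∀ v : Fin l → H, ∃ c : Fin t → B, ∀ j, v j = ∑ s, c s * w s j)
    {V : Submodule k H} (hV : ∀ b : B, φ b = 0 → ∀ h, (b : H) * h ∈ V)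
    (hd : t * d ^ 2 = l * Module.finrank k (H ⧸ V))
    {c : Fin t → B} (hc : ∀ j, ∑ s, c s * w s j = 0) (s : Fin t) : c s = 0 := by
  let ι : B ⊗[k] H →ₗ[k] H ⊗[k] H := B.val.toLinearMap.rTensor H
  have hlift : ∀ z : B, ∃ y, ι y = (antipode k).lTensor H (comul (R := k) (z : H)) := by
    intro z
    obtain ⟨u, hu⟩ := hB z z.2
    refine ⟨(antipode k ∘ₗ B.val.toLinearMap).lTensor B u, ?_⟩
    rw [← hu]
    simp only [ι, LinearMap.rTensor, LinearMap.lTensor, ← LinearMap.comp_apply,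
      ← TensorProduct.map_comp]
    rfl
  have hι : ∀ (b : H →ₗ[k] k) y, ((sliceR b y : B) : H) = sliceR b (ι y) := fun b y => by
    simp only [ι, LinearMap.rTensor, sliceR_map]
    rfl
  let G : (Fin t → B ⊗[k] H) →ₗ[k] (Fin l → H ⊗[k] H) := LinearMap.pi fun j => ∑ s,
    LinearMap.mulRight k (w s j ⊗ₜ[k] (1 : H)) ∘ₗ twist k H ∘ₗ ι ∘ₗ LinearMap.proj s
  have hG : ∀ y j, G y j = ∑ s, twist k H (ι (y s)) * (w s j ⊗ₜ[k] 1) := fun y j => by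
    simp [G]
  have hGlift : ∀ (z : Fin t → B) (y : Fin t → B ⊗[k] H),
      (∀ s, ι (y s) = (antipode k).lTensor H (comul (R := k) (z s : H))) →
      ∀ j, G y j = (∑ s, z s * w s j) ⊗ₜ[k] 1 := by
    intro z y hy j
    rw [hG]
    simp [hy, twist_lTensor_antipode_comul, TensorProduct.sum_tmul]
  have hGsurj : Function.Surjective G := by
    rw [← LinearMap.range_eq_top, eq_top_iff]
    have hsingle : ∀ (j : Fin l) (h u : H),
        (Pi.single j (h ⊗ₜ[k] u) : Fin l → H ⊗[k] H) ∈ LinearMap.range G := by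
      intro j h u
      obtain ⟨z, hz⟩ := hw (Pi.single j h)
      choose y hy using fun s => hlift (z s)
      refine ⟨fun s => y s * (1 ⊗ₜ[k] u), ?_⟩
      have hmul : ∀ x, ι (x * (1 ⊗ₜ[k] u)) = ι x * (1 ⊗ₜ[k] u) := fun x => by
        induction x with
        | zero => simp
        | tmul a b => simp [ι]
        | add a b ha hb => rw [add_mul, map_add, ha, hb, map_add, add_mul]
      ext1 i
      have h1 := congrArg (· * ((1 : H) ⊗ₜ[k] u)) (hGlift z y hy i)
      simp only [← hz i, hG, Finset.sum_mul] at h1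
      rw [hG]
      simp only [hmul, twist_mul_one_tmul]
      have h2 : ∀ s, twist k H (ι (y s)) * (1 ⊗ₜ[k] u) * (w s i ⊗ₜ[k] 1) =
          twist k H (ι (y s)) * (w s i ⊗ₜ[k] 1) * (1 ⊗ₜ[k] u) := fun s => by
        rw [mul_assoc, mul_assoc]
        simp
      simp only [h2, h1]
      obtain rfl | hi := eq_or_ne i j
      · simp
      · simp [Pi.single_eq_of_ne hi]
    intro v _
    rw [← Finset.univ_sum_single v]
    refine sum_mem fun j _ => ?_
    induction v j with
    | zero => simp
    | tmul a b => exact hsingle j a b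
    | add a b ha hb => rw [Pi.single_add]; exact add_mem ha hb
  let g : (Fin t → B ⊗[k] H) →ₗ[k] (Fin l → (H ⧸ V) ⊗[k] H) :=
    LinearMap.pi fun j => V.mkQ.rTensor H ∘ₗ untwist k H ∘ₗ LinearMap.proj j ∘ₗ G
  let q : (Fin t → B ⊗[k] H) →ₗ[k] (Fin t → Matrix (Fin d) (Fin d) k ⊗[k] H) :=
    LinearMap.pi fun s => φ.toLinearMap.rTensor H ∘ₗ LinearMap.proj s
  have hgsurj : Function.Surjective g := by
    intro v
    choose x hx using fun j => LinearMap.rTensor_surjective H V.mkQ_surjective (v j)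
    obtain ⟨y, hy⟩ := hGsurj fun j => twist k H (x j)
    refine ⟨y, funext fun j => ?_⟩
    change V.mkQ.rTensor H (untwist k H (G y j)) = v j
    rw [hy, untwist_twist, hx]
  have hqsurj : Function.Surjective q := by
    intro v
    choose x hx using fun s =>
      LinearMap.rTensor_surjective H (g := φ.toLinearMap) hφ (v s)
    exact ⟨x, funext hx⟩
  have hq : ∀ y, q y = 0 → ∀ s b, φ (sliceR b (y s)) = 0 := by
    intro y hy s b
    have h1 := congrArg (sliceR b) (congrFun hy s)
    change sliceR b (TensorProduct.map φ.toLinearMap LinearMap.id (y s)) = sliceR b 0 at h1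
    rw [sliceR_map, map_zero] at h1
    exact h1
  let P : Submodule k H := (LinearMap.ker φ.toLinearMap).map B.val.toLinearMap
  have hP : ∀ y, q y = 0 → ∀ s, ι (y s) ∈ tensorSM k H P ⊤ := fun y hy s =>
    mem_tensorSM_iff.2 ⟨fun b => ⟨sliceR b (y s), hq y hy s b, hι b _⟩,
      fun _ => Submodule.mem_top⟩
  have hqg : LinearMap.ker q ≤ LinearMap.ker g := by
    intro y hy
    have hy := hP y hy
    refine LinearMap.mem_ker.2 (funext fun j => ?_)
    change V.mkQ.rTensor H (untwist k H (G y j)) = 0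
    rw [hG, map_sum, map_sum]
    refine Finset.sum_eq_zero fun s _ => ?_
    have h1 : (V.mkQ.rTensor H ∘ₗ untwist k H ∘ₗ LinearMap.mulRight k (w s j ⊗ₜ[k] (1 : H)) ∘ₗ
        twist k H) (ι (y s)) ∈ (⊥ : Submodule k ((H ⧸ V) ⊗[k] H)) := by
      refine map_mem_of_mem_tensorSM _ (fun p hp u _ => ?_) (hy s)
      obtain ⟨b, hb, rfl⟩ := hp
      have h2 : twist k H (B.val b ⊗ₜ[k] u) * (w s j ⊗ₜ[k] 1) =
          twist k H ((B.val b ⊗ₜ[k] 1) * untwist k H (w s j ⊗ₜ[k] u)) := by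
        rw [twist_tmul_one_mul, twist_untwist, twist_tmul, mul_assoc]
        simp
      have h3 : ∀ x : H ⊗[k] H, V.mkQ.rTensor H ((B.val b ⊗ₜ[k] 1) * x) = 0 := by
        intro x
        induction x with
        | zero => simp
        | tmul m n =>
          have := (Submodule.Quotient.mk_eq_zero V).2 (hV b hb m)
          simp [this]
        | add m n hm hn => rw [mul_add, map_add, hm, hn, add_zero]
      change V.mkQ.rTensor H (untwist k H (twist k H (B.val b ⊗ₜ[k] u) * (w s j ⊗ₜ[k] 1))) = 0
      rw [h2, untwist_twist, h3]
    exact h1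
  have hgq := ker_le_ker_of_finrank_eq hqsurj hgsurj hqg (by
    simp only [Module.finrank_pi_fintype, Module.finrank_tensorProduct, Finset.sum_const,
      Finset.card_univ, Fintype.card_fin, smul_eq_mul, Module.finrank_matrix, Module.finrank_self]
    rw [← mul_assoc l, ← hd]
    ring)
  choose y hy using fun s => hlift (c s)
  have hqy : q y = 0 := hgq (by
    refine LinearMap.mem_ker.2 (funext fun j => ?_)
    change V.mkQ.rTensor H (untwist k H (G y j)) = 0
    rw [hGlift c y hy, hc]
    simp)
  refine Subtype.ext (eq_zero_of_forall_hitR_antipode_mem (k := k) (B := Subalgebra.toSubmodule B)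
    (P := P) hB B.one_mem ?_ ?_ ?_ fun e => ?_)
  · rintro _ ⟨b, _, rfl⟩
    exact b.2
  · rintro b hb _ ⟨x, hx, rfl⟩
    refine ⟨⟨b, hb⟩ * x, ?_, rfl⟩
    rw [SetLike.mem_coe, LinearMap.mem_ker] at hx ⊢
    change φ _ = 0 at hx
    change φ _ = 0
    rw [map_mul, hx, mul_zero]
  · rintro ⟨b, hb, hb1⟩
    have : b = 1 := Subtype.ext hb1
    rw [this] at hb
    have hb : φ 1 = 0 := hb
    rw [map_one] at hb
    exact one_ne_zero hb
  · have := hq y hqy s e.ofConv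
    refine ⟨_, this, ?_⟩
    change ((sliceR e.ofConv (y s) : B) : H) = _
    rw [hι, hy, LinearMap.lTensor, sliceR_map]
    rfl

/-- The dimension of a sub-bialgebra divides that of a finite-dimensional Hopf algebra. -/
theorem finrank_dvd_finrank_of_subbialgebra [IsAlgClosed k]
    (hB : ∀ x ∈ B, comul (R := k) x ∈ tensorSM k H (Subalgebra.toSubmodule B)
      (Subalgebra.toSubmodule B)) :
    Module.finrank k B ∣ Module.finrank k H := by
  have : Nontrivial H := ⟨1, 0, fun h => by
    have := congrArg (counit (R := k)) h
    simp at this⟩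
  obtain ⟨n, d, φ, hd, hφ, N, hN⟩ := exists_algHom_pi_matrix k B
  have : Nonempty (Fin n) := by
    by_contra hn
    rw [not_nonempty_iff] at hn
    have h1 : ∀ m, (1 : B) ∈ (LinearMap.ker φ.toLinearMap) ^ m := by
      intro m
      induction m with
      | zero => rw [pow_zero]; exact Submodule.one_le.1 le_rfl
      | succ m ih =>
        rw [pow_succ, ← one_mul (1 : B)]
        exact Submodule.mul_mem_mul ih (LinearMap.mem_ker.2 (Subsingleton.elim _ _))
    have := h1 N
    rw [hN, Submodule.mem_bot] at this
    exact one_ne_zero this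
  let V : Fin n → Submodule k H := fun i =>
    Submodule.span k {x | ∃ b : B, φ b i = 0 ∧ ∃ h : H, x = b • h}
  obtain ⟨i, hi⟩ := Finite.exists_max
    fun i => (Module.finrank k (H ⧸ V i) : ℚ) / (d i : ℚ) ^ 2
  have hdpos : ∀ i, (0 : ℚ) < (d i : ℚ) ^ 2 := fun i =>
    pow_pos (Nat.cast_pos.2 (Nat.pos_of_ne_zero (hd i).out)) 2
  have hquot : ∀ (l : ℕ) (V : Submodule k H), Module.finrank k
      ((Fin l → H) ⧸ Submodule.pi Set.univ fun _ => V) = l * Module.finrank k (H ⧸ V) := by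
    intro l V
    rw [(Submodule.quotientPi fun _ : Fin l => V).finrank_eq, Module.finrank_pi_fintype]
    simp
  obtain ⟨w, hw⟩ := exists_generators_of_finrank_quotient_le (W := Fin (d i ^ 2) → H) φ hφ hN
    (fun i => Submodule.pi Set.univ fun _ => V i) (t := Module.finrank k (H ⧸ V i))
    (fun j b v hb => fun m _ => Submodule.subset_span ⟨b, hb, v m, rfl⟩)
    (by
      intro j v hv
      rw [← Finset.univ_sum_single v]
      refine sum_mem fun m _ => ?_
      have : V j ≤ (Submodule.span k {x | ∃ b : B, φ b j = 0 ∧ ∃ w : Fin (d i ^ 2) → H,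
          x = b • w}).comap (LinearMap.single k (fun _ => H) m) := by
        refine Submodule.span_le.2 ?_
        rintro _ ⟨b, hb, h, rfl⟩
        exact Submodule.subset_span ⟨b, hb, Pi.single m h, by
          rw [LinearMap.single_apply, Pi.single_smul]⟩
      exact this (hv m trivial))
    (by
      intro j
      rw [hquot]
      have := hi j
      rw [div_le_div_iff₀ (hdpos j) (hdpos i)] at this
      rw [mul_comm]
      exact_mod_cast this)
  let F : (Fin (Module.finrank k (H ⧸ V i)) → B) →ₗ[k] (Fin (d i ^ 2) → H) :=
    LinearMap.pi fun j => ∑ s, LinearMap.mulRight k (w s j) ∘ₗ B.val.toLinearMap ∘ₗ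
      LinearMap.proj s
  have hF : ∀ c j, F c j = ∑ s, c s * w s j := fun c j => by simp [F]
  have hFsurj : Function.Surjective F := fun v => by
    obtain ⟨c, hc⟩ := hw v
    refine ⟨c, funext fun j => ?_⟩
    rw [hF, hc, Finset.sum_apply]
    rfl
  have hFinj : Function.Injective F := by
    refine (injective_iff_map_eq_zero F).2 fun c hc => funext fun s => ?_
    refine eq_zero_of_sum_mul_eq_zero hB ((Pi.evalAlgHom k _ i).comp φ) ?_ w ?_ (V := V i)
      (fun b hb h => Submodule.subset_span ⟨b, hb, h, rfl⟩) (mul_comm _ _) ?_ s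
    · intro x
      obtain ⟨b, hb⟩ := hφ (Pi.single i x)
      exact ⟨b, by simp [hb]⟩
    · intro v
      obtain ⟨c, hc⟩ := hFsurj v
      exact ⟨c, fun j => by rw [← hF, hc]⟩
    · intro j
      rw [← hF, hc]
      rfl
  have h1 := (LinearEquiv.ofBijective F ⟨hFinj, hFsurj⟩).finrank_eq
  rw [Module.finrank_pi_fintype, Module.finrank_pi_fintype] at h1
  simp only [Finset.sum_const, Finset.card_univ, Fintype.card_fin, smul_eq_mul] at h1
  let ε : (Fin (Module.finrank k (H ⧸ V i)) → B) →ₗ[k]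
      (Fin (Module.finrank k (H ⧸ V i)) → k) :=
    LinearMap.pi fun s => counit ∘ₗ B.val.toLinearMap ∘ₗ LinearMap.proj s
  have hε : Function.Surjective ε := fun v => ⟨fun s => algebraMap k B (v s), funext fun s => by
    change counit (R := k) (algebraMap k H (v s)) = v s
    simp⟩
  let V₀ : Submodule k H := Submodule.span k {x | ∃ b ∈ B, counit (R := k) b = 0 ∧
    ∃ h : H, x = b * h}
  let K := LinearMap.ker ε
  have hK : K.map F = Submodule.pi Set.univ fun _ => V₀ := by
    apply le_antisymm
    · rintro _ ⟨c, hc, rfl⟩ j -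
      rw [hF]
      exact sum_mem fun s _ => Submodule.subset_span ⟨c s, (c s).2, congrFun hc s, _, rfl⟩
    · intro v hv
      rw [← Finset.univ_sum_single v]
      refine sum_mem fun m _ => ?_
      have : V₀ ≤ (K.map F).comap (LinearMap.single k (fun _ => H) m) := by
        refine Submodule.span_le.2 ?_
        rintro _ ⟨b, hb, hb0, h, rfl⟩
        obtain ⟨c, hc⟩ := hFsurj (Pi.single m h)
        refine ⟨fun s => ⟨b, hb⟩ * c s, funext fun s => ?_, funext fun j => ?_⟩
        · change counit (R := k) (b * (c s : H)) = 0
          rw [Bialgebra.counit_mul, hb0, zero_mul]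
        · rw [hF]
          have h2 := congrFun hc j
          rw [hF] at h2
          simp only [MulMemClass.coe_mul, mul_assoc, ← Finset.mul_sum, h2]
          obtain rfl | hj := eq_or_ne j m
          · simp
          · simp [Pi.single_eq_of_ne hj]
      exact this (hv m trivial)
  have h2 := hquot (d i ^ 2) V₀
  have h3 := ε.finrank_range_add_finrank_ker
  have h4 := (Submodule.pi Set.univ fun _ : Fin (d i ^ 2) => V₀).finrank_quotient_add_finrank
  rw [LinearMap.range_eq_top.2 hε, finrank_top, Module.finrank_fin_fun,
    (Submodule.equivMapOfInjective F hFinj K).finrank_eq, hK,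
    (LinearEquiv.ofBijective F ⟨hFinj, hFsurj⟩).finrank_eq] at h3
  have h5 : Module.finrank k (H ⧸ V i) = d i ^ 2 * Module.finrank k (H ⧸ V₀) := by omega
  rw [h5, mul_assoc] at h1
  refine ⟨Module.finrank k (H ⧸ V₀), ?_⟩
  rw [← Nat.eq_of_mul_eq_mul_left (pow_pos (Nat.pos_of_ne_zero (hd i).out) 2) h1, mul_comm]

end Freeness

section Coefficients

open WithConv

variable {k : Type*} [Field k] {H : Type*} [AddCommGroup H] [Module k H] [Coalgebra k H]
  [FiniteDimensional k H]

omit [Coalgebra k H] in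
lemma exists_forall_apply_eq (F : WithConv (H →ₗ[k] k) →ₗ[k] k) : ∃ x : H, ∀ f, f x = F f := by
  refine ⟨(Module.evalEquiv k H).symm (F ∘ₗ (WithConv.linearEquiv k (H →ₗ[k] k)).symm), fun f => ?_⟩
  exact Module.apply_evalEquiv_symm_apply (R := k) (M := H) f.ofConv _

variable {n : ℕ} {d : Fin n → ℕ}
  (φ : WithConv (H →ₗ[k] k) →ₐ[k] Π i, Matrix (Fin (d i)) (Fin (d i)) k)

/-- The matrix coefficients of a representation of the dual algebra. -/
noncomputable def coeff (i : Fin n) (a b : Fin (d i)) : H :=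
  (exists_forall_apply_eq (Matrix.entryLinearMap k k a b ∘ₗ LinearMap.proj i ∘ₗ
    φ.toLinearMap)).choose

/-- The span of the matrix coefficients of the `i`-th component. -/
noncomputable def block (i : Fin n) : Submodule k H :=
  Submodule.span k (Set.range fun p : Fin (d i) × Fin (d i) => coeff φ i p.1 p.2)

lemma apply_coeff (f : WithConv (H →ₗ[k] k)) (i : Fin n) (a b : Fin (d i)) :
    f (coeff φ i a b) = φ f i a b :=
  (exists_forall_apply_eq (Matrix.entryLinearMap k k a b ∘ₗ
    LinearMap.proj (φ := fun i => Matrix (Fin (d i)) (Fin (d i)) k) i ∘ₗ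
    φ.toLinearMap)).choose_spec f

lemma coeff_mem_block (i : Fin n) (a b : Fin (d i)) : coeff φ i a b ∈ block φ i :=
  Submodule.subset_span ⟨(a, b), rfl⟩

lemma hitL_coeff (f : WithConv (H →ₗ[k] k)) (i : Fin n) (a b : Fin (d i)) :
    hitL f (coeff φ i a b) = ∑ c, φ f i a c • coeff φ i c b :=
  ext_conv fun g => by
    rw [← conv_apply_eq_hitL, apply_coeff, map_mul, Pi.mul_apply, Matrix.mul_apply, map_sum]
    simp [apply_coeff]

lemma hitR_coeff (f : WithConv (H →ₗ[k] k)) (i : Fin n) (a b : Fin (d i)) :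
    hitR f (coeff φ i a b) = ∑ c, φ f i c b • coeff φ i a c :=
  ext_conv fun g => by
    rw [← conv_apply_eq_hitR, apply_coeff, map_mul, Pi.mul_apply, Matrix.mul_apply, map_sum]
    simp [apply_coeff, mul_comm]

lemma forall_mem_block_apply_eq_zero {f : WithConv (H →ₗ[k] k)} {i : Fin n} :
    (∀ x ∈ block φ i, f x = 0) ↔ φ f i = 0 := by
  constructor
  · intro h
    ext a b
    rw [← apply_coeff, h _ (coeff_mem_block φ i a b), Matrix.zero_apply]
  · intro h x hx
    have : block φ i ≤ LinearMap.ker f.ofConv := by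
      refine Submodule.span_le.2 ?_
      rintro _ ⟨p, rfl⟩
      change f (coeff φ i p.1 p.2) = 0
      rw [apply_coeff, h, Matrix.zero_apply]
    exact this hx

omit [Coalgebra k H] [FiniteDimensional k H] in
lemma mem_of_forall_apply_eq_zero {D : Submodule k H} {x : H}
    (h : ∀ f : WithConv (H →ₗ[k] k), (∀ y ∈ D, f y = 0) → f x = 0) : x ∈ D := by
  by_contra hx
  obtain ⟨f, hf, hD⟩ := Submodule.exists_le_ker_of_notMem hx
  exact hf (h (toConv f) fun y hy => hD hy)

omit [FiniteDimensional k H] in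
lemma hitL_mem_of_isSubcoalg {D : Submodule k H} (hD : IsSubcoalgWrt k (comulL k H) D)
    (f : WithConv (H →ₗ[k] k)) {x : H} (hx : x ∈ D) : hitL f x ∈ D :=
  (mem_tensorSM_iff.1 (hD x hx)).2 f.ofConv

omit [FiniteDimensional k H] in
lemma hitR_mem_of_isSubcoalg {D : Submodule k H} (hD : IsSubcoalgWrt k (comulL k H) D)
    (f : WithConv (H →ₗ[k] k)) {x : H} (hx : x ∈ D) : hitR f x ∈ D :=
  (mem_tensorSM_iff.1 (hD x hx)).1 f.ofConv

omit [FiniteDimensional k H] in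
lemma isSubcoalg_of_forall_hit_mem {D : Submodule k H}
    (hL : ∀ (f : WithConv (H →ₗ[k] k)), ∀ x ∈ D, hitL f x ∈ D)
    (hR : ∀ (f : WithConv (H →ₗ[k] k)), ∀ x ∈ D, hitR f x ∈ D) :
    IsSubcoalgWrt k (comulL k H) D := fun x hx =>
  mem_tensorSM_iff.2 ⟨fun b => hR (toConv b) x hx, fun a => hL (toConv a) x hx⟩

lemma isSubcoalg_block (i : Fin n) : IsSubcoalgWrt k (comulL k H) (block φ i) := by
  refine isSubcoalg_of_forall_hit_mem (fun f => ?_) (fun f => ?_)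
  · change block φ i ≤ (block φ i).comap (hitL f)
    refine Submodule.span_le.2 ?_
    rintro _ ⟨p, rfl⟩
    change hitL f (coeff φ i p.1 p.2) ∈ block φ i
    rw [hitL_coeff]
    exact sum_mem fun c _ => Submodule.smul_mem _ _ (coeff_mem_block φ i _ _)
  · change block φ i ≤ (block φ i).comap (hitR f)
    refine Submodule.span_le.2 ?_
    rintro _ ⟨p, rfl⟩
    change hitR f (coeff φ i p.1 p.2) ∈ block φ i
    rw [hitR_coeff]
    exact sum_mem fun c _ => Submodule.smul_mem _ _ (coeff_mem_block φ i _ _)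

variable {φ} (hφ : Function.Surjective φ)
include hφ

lemma finrank_block (i : Fin n) : Module.finrank k (block φ i) = d i ^ 2 := by
  have hli : LinearIndependent k
      (fun p : Fin (d i) × Fin (d i) => coeff φ i p.1 p.2) := by
    rw [Fintype.linearIndependent_iff]
    intro c hc p
    obtain ⟨f, hf⟩ := hφ (blockUnit i p.1 p.2)
    have h := congrArg f hc
    rw [map_sum, map_zero] at h
    simpa [apply_coeff, hf, blockUnit_apply_same, ← Prod.ext_iff] using h
  rw [block, finrank_span_eq_card hli, Fintype.card_prod, Fintype.card_fin, sq]

variable [∀ i, NeZero (d i)]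

lemma block_le_block_iff {i j : Fin n} : block φ i ≤ block φ j ↔ i = j := by
  refine ⟨fun h => ?_, fun h => h ▸ le_rfl⟩
  by_contra hij
  obtain ⟨f, hf⟩ := hφ (blockUnit i 0 0)
  have h1 := (forall_mem_block_apply_eq_zero φ (f := f) (i := j)).2 (by
    ext a b
    rw [hf, blockUnit_apply_ne (Ne.symm hij), Matrix.zero_apply]) _ (h (coeff_mem_block φ i 0 0))
  rw [apply_coeff, hf, blockUnit_apply_same] at h1
  simp at h1

lemma block_ne_bot (i : Fin n) : block φ i ≠ ⊥ := by
  intro h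
  have := finrank_block hφ i
  rw [h, finrank_bot] at this
  exact pow_ne_zero 2 (NeZero.ne (d i)) this.symm

omit [∀ i, NeZero (d i)] in
lemma exists_block_le {N : ℕ} (hN : (LinearMap.ker φ.toLinearMap) ^ N = ⊥) {D : Submodule k H}
    (hD : IsSubcoalgWrt k (comulL k H) D) (hD0 : D ≠ ⊥) : ∃ i, block φ i ≤ D := by
  by_contra! hcon
  have hex : ∀ i, ∃ f : WithConv (H →ₗ[k] k), (∀ y ∈ D, f y = 0) ∧ φ f i ≠ 0 := by
    intro i
    by_contra! h
    exact hcon i fun x hx => mem_of_forall_apply_eq_zero fun f hf =>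
      (forall_mem_block_apply_eq_zero φ).2 (h f hf) x hx
  let K : Submodule k (WithConv (H →ₗ[k] k)) :=
    { carrier := {f | ∀ y ∈ D, f y = 0}
      add_mem' := fun {a b} ha hb y hy => by
        change a y + b y = 0
        rw [ha y hy, hb y hy, add_zero]
      zero_mem' := fun y _ => rfl
      smul_mem' := fun c f hf y hy => by
        change c • f y = 0
        rw [hf y hy, smul_zero] }
  have hmulL : ∀ f ∈ K, ∀ g, g * f ∈ K := fun f hf g y hy => by
    rw [conv_apply_eq_hitL]
    exact hf _ (hitL_mem_of_isSubcoalg hD g hy)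
  have hmulR : ∀ f ∈ K, ∀ g, f * g ∈ K := fun f hf g y hy => by
    rw [conv_apply_eq_hitR]
    exact hf _ (hitR_mem_of_isSubcoalg hD g hy)
  have hunit : ∀ i c, ∃ f ∈ K, φ f = blockUnit i c c := by
    intro i c
    obtain ⟨f, hf, hf0⟩ := hex i
    obtain ⟨a, b, hab⟩ : ∃ a b, φ f i a b ≠ 0 := by
      by_contra! h
      exact hf0 (Matrix.ext h)
    obtain ⟨u, hu⟩ := hφ (blockUnit i c a)
    obtain ⟨v, hv⟩ := hφ (blockUnit i b c)
    refine ⟨(φ f i a b)⁻¹ • (u * f * v), K.smul_mem _ (hmulR _ (hmulL f hf u) v), ?_⟩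
    rw [map_smul, map_mul, map_mul, hu, hv, blockUnit_mul, Finset.sum_mul]
    simp [blockUnit_mul_same, hab]
  choose f hfK hf using hunit
  have h1 : ∑ i, ∑ c, f i c ∈ K := sum_mem fun i _ => sum_mem fun c _ => hfK i c
  set g := ∑ i, ∑ c, f i c with hg
  have hφg : φ (1 - g) = 0 := by
    rw [map_sub, map_one, hg, map_sum, sub_eq_zero]
    simp only [map_sum, hf, sum_blockUnit]
  have hpow : ∀ m, (1 - g) ^ m ∈ (LinearMap.ker φ.toLinearMap) ^ m ∧ 1 - (1 - g) ^ m ∈ K := by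
    intro m
    induction m with
    | zero =>
      rw [pow_zero, pow_zero, sub_self]
      exact ⟨Submodule.one_le.1 le_rfl, K.zero_mem⟩
    | succ m ih =>
      rw [pow_succ, pow_succ]
      refine ⟨Submodule.mul_mem_mul ih.1 hφg, ?_⟩
      have : 1 - (1 - g) ^ m * (1 - g) = (1 - (1 - g) ^ m) + (1 - g) ^ m * g := by
        rw [mul_sub, mul_one]
        abel
      rw [this]
      exact K.add_mem ih.2 (hmulL g h1 _)
  obtain ⟨h2, h3⟩ := hpow N
  rw [hN, Submodule.mem_bot] at h2
  rw [h2, sub_zero] at h3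
  refine hD0 (eq_bot_iff.2 fun x hx => (Submodule.mem_bot k).2 (ext_conv (k := k) fun e => ?_))
  rw [← mul_one e, map_zero]
  exact hmulL 1 h3 e x hx

lemma isSimpleSubcoalg_iff {N : ℕ} (hN : (LinearMap.ker φ.toLinearMap) ^ N = ⊥)
    {D : Submodule k H} :
    IsSimpleSubcoalgWrt k (comulL k H) D ↔ ∃ i, D = block φ i := by
  constructor
  · rintro ⟨hD, hD0, hmin⟩
    obtain ⟨i, hi⟩ := exists_block_le hφ hN hD hD0
    refine ⟨i, ?_⟩
    by_contra hne
    exact block_ne_bot hφ i (hmin _ (isSubcoalg_block φ i) (lt_of_le_of_ne hi (Ne.symm hne)))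
  · rintro ⟨i, rfl⟩
    refine ⟨isSubcoalg_block φ i, block_ne_bot hφ i, fun D hD hlt => ?_⟩
    by_contra hD0
    obtain ⟨j, hj⟩ := exists_block_le hφ hN hD hD0
    obtain rfl := (block_le_block_iff hφ).1 (hj.trans hlt.le)
    exact hlt.not_ge hj

lemma coradical_eq_iSup_block {N : ℕ} (hN : (LinearMap.ker φ.toLinearMap) ^ N = ⊥) :
    coradical k H = ⨆ i, block φ i := by
  rw [coradical, iSup]
  congr 1
  ext D
  simp only [Set.mem_ofPred_eq, isSimpleSubcoalg_iff hφ hN, Set.mem_range, eq_comm]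

lemma forall_mem_coradical_apply_eq_zero {N : ℕ}
    (hN : (LinearMap.ker φ.toLinearMap) ^ N = ⊥) {f : WithConv (H →ₗ[k] k)} :
    (∀ x ∈ coradical k H, f x = 0) ↔ φ f = 0 := by
  rw [coradical_eq_iSup_block hφ hN]
  constructor
  · exact fun h => funext fun i => (forall_mem_block_apply_eq_zero φ).1 fun x hx =>
      h x (Submodule.mem_iSup_of_mem i hx)
  · intro h x hx
    have : ⨆ i, block φ i ≤ LinearMap.ker f.ofConv := iSup_le fun i y hy =>
      (forall_mem_block_apply_eq_zero φ).2 (congrFun h i) y hy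
    exact this hx

lemma exists_span_eq_block_of_isGrouplike {N : ℕ}
    (hN : (LinearMap.ker φ.toLinearMap) ^ N = ⊥) {g : H} (hg : g ∈ grouplikes k H) :
    ∃ i, d i = 1 ∧ Submodule.span k {g} = block φ i := by
  have hsub : IsSubcoalgWrt k (comulL k H) (Submodule.span k {g}) := by
    intro x hx
    obtain ⟨c, rfl⟩ := Submodule.mem_span_singleton.1 hx
    have : comulL k H (c • g) = (c • g) ⊗ₜ[k] g := by
      rw [map_smul, hg.2, TensorProduct.smul_tmul']
    rw [this]
    exact tmul_mem_tensorSM hx (Submodule.mem_span_singleton_self g)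
  obtain ⟨i, hi⟩ := exists_block_le hφ hN hsub (by simpa using hg.1)
  have h1 := finrank_span_singleton (K := k) hg.1
  have h2 := Submodule.finrank_mono hi
  rw [finrank_block hφ, h1] at h2
  have h3 : 0 < d i := Nat.pos_of_ne_zero (NeZero.ne _)
  have h4 : d i = 1 := by nlinarith
  refine ⟨i, h4, (Submodule.eq_of_le_of_finrank_eq hi ?_).symm⟩
  rw [finrank_block hφ, h1, h4, one_pow]

omit [∀ i, NeZero (d i)] in
lemma exists_isGrouplike_span_eq_block {i : Fin n} (hi : d i = 1) :
    ∃ g ∈ grouplikes k H, Submodule.span k {g} = block φ i := by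
  have h0 : 0 < d i := by omega
  have huniq : ∀ a : Fin (d i), a = ⟨0, h0⟩ := fun a => by ext; simp; omega
  have hspan : Submodule.span k {coeff φ i ⟨0, h0⟩ ⟨0, h0⟩} = block φ i := by
    rw [block]
    congr 1
    ext x
    constructor
    · rintro rfl
      exact ⟨(⟨0, h0⟩, ⟨0, h0⟩), rfl⟩
    · rintro ⟨⟨a, b⟩, rfl⟩
      rw [huniq a, huniq b]
      rfl
  refine ⟨coeff φ i ⟨0, h0⟩ ⟨0, h0⟩, ⟨?_, ?_⟩, hspan⟩
  · intro h
    have h1 := finrank_block hφ i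
    rw [← hspan, h, Submodule.span_zero_singleton, finrank_bot, hi] at h1
    simp at h1
  · refine ext_sliceR fun b => ?_
    change hitR (toConv b) _ = _
    rw [hitR_coeff, sliceR_tmul]
    have hsum : ∀ f : Fin (d i) → H, ∑ c, f c = f ⟨0, h0⟩ := fun f =>
      Fintype.sum_eq_single _ fun a ha => absurd (huniq a) ha
    rw [hsum, ← apply_coeff]

end Coefficients

section Section

open WithConv

variable {k : Type*} [Field k] {H : Type*} [AddCommGroup H] [Module k H] [Coalgebra k H]
  [FiniteDimensional k H] {n : ℕ} {d : Fin n → ℕ}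
  {φ : WithConv (H →ₗ[k] k) →ₐ[k] Π i, Matrix (Fin (d i)) (Fin (d i)) k}
  {π₀ : H →ₗ[k] H}

/-- A coalgebra projection onto the coradical dualizes to a section of the quotient of the dual
algebra by its radical. -/
lemma exists_section [∀ i, NeZero (d i)] {N : ℕ} (hN : (LinearMap.ker φ.toLinearMap) ^ N = ⊥)
    (hφ : Function.Surjective φ)
    (hproj : ∀ x ∈ coradical k H, π₀ x = x) (hrange : LinearMap.range π₀ = coradical k H)
    (hcoalg : TensorProduct.map π₀ π₀ ∘ₗ comulL k H = comulL k H ∘ₗ π₀)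
    (hcounit : (Coalgebra.counit : H →ₗ[k] k) ∘ₗ π₀ = Coalgebra.counit) :
    ∃ σ : (Π i, Matrix (Fin (d i)) (Fin (d i)) k) →ₐ[k] WithConv (H →ₗ[k] k),
      (∀ m, φ (σ m) = m) ∧ ∀ f x, σ (φ f) x = f (π₀ x) := by
  let ρ : WithConv (H →ₗ[k] k) → WithConv (H →ₗ[k] k) := fun f => toConv (f.ofConv ∘ₗ π₀)
  have hρmul : ∀ f g, ρ (f * g) = ρ f * ρ g := fun f g => by
    ext x
    change (f * g) (π₀ x) = _
    rw [LinearMap.convMul_apply, LinearMap.convMul_apply]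
    have := LinearMap.congr_fun hcoalg x
    rw [LinearMap.comp_apply, LinearMap.comp_apply] at this
    rw [← this, ← LinearMap.comp_apply (TensorProduct.map _ _), ← TensorProduct.map_comp]
  have hρ : ∀ f g, φ f = φ g → ρ f = ρ g := fun f g hfg => by
    ext x
    change f (π₀ x) = g (π₀ x)
    have h1 : φ (f - g) = 0 := by rw [map_sub, hfg, sub_self]
    have h2 := (forall_mem_coradical_apply_eq_zero hφ hN).2 h1 (π₀ x)
      (hrange ▸ LinearMap.mem_range_self π₀ x)
    exact sub_eq_zero.1 h2
  have hφρ : ∀ f, φ (ρ f) = φ f := fun f => by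
    rw [← sub_eq_zero, ← map_sub]
    refine (forall_mem_coradical_apply_eq_zero hφ hN).1 fun x hx => ?_
    change f (π₀ x) - f x = 0
    rw [hproj x hx, sub_self]
  have hs := Function.surjInv_eq hφ
  refine ⟨AlgHom.ofLinearMap
    { toFun := fun m => ρ (Function.surjInv hφ m)
      map_add' := fun a b => hρ _ (Function.surjInv hφ a + Function.surjInv hφ b)
        (by rw [map_add, hs, hs, hs])
      map_smul' := fun c a => hρ _ (c • Function.surjInv hφ a) (by rw [map_smul, hs, hs]) }
    ((hρ _ 1 (by rw [hs, map_one])).trans (WithConv.ext hcounit))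
    (fun a b => (hρ _ (Function.surjInv hφ a * Function.surjInv hφ b)
      (by rw [map_mul, hs, hs, hs])).trans (hρmul _ _)), fun m => ?_, fun f x => ?_⟩
  · exact (hφρ _).trans (hs m)
  · change ρ (Function.surjInv hφ (φ f)) x = _
    rw [hρ _ f (hs _)]
    rfl

variable {σ : (Π i, Matrix (Fin (d i)) (Fin (d i)) k) →ₐ[k] WithConv (H →ₗ[k] k)}
  (hφσ : ∀ m, φ (σ m) = m) (hσ : ∀ f x, σ (φ f) x = f (π₀ x))

omit [FiniteDimensional k H] in
include hφσ hσ in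
lemma section_apply_proj (m x) : σ m (π₀ x) = σ m x := by
  rw [← hσ, hφσ]

omit [FiniteDimensional k H] in
include hφσ hσ in
lemma hitL_section_proj (m x) : hitL (σ m) (π₀ x) = π₀ (hitL (σ m) x) :=
  ext_conv fun a => by
    rw [← conv_apply_eq_hitL, ← hσ, map_mul, map_mul, hφσ, ← hσ, ← conv_apply_eq_hitL]

omit [FiniteDimensional k H] in
include hφσ hσ in
lemma hitR_section_proj (m x) : hitR (σ m) (π₀ x) = π₀ (hitR (σ m) x) :=
  ext_conv fun a => by
    rw [← conv_apply_eq_hitR, ← hσ, map_mul, map_mul, hφσ, ← hσ, ← conv_apply_eq_hitR]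

include hφσ in
lemma one_sub_section_single_apply {i : Fin n} {x : H} (hx : x ∈ block φ i) :
    (1 - σ (Pi.single i 1)) x = 0 := by
  refine (forall_mem_block_apply_eq_zero φ).2 ?_ x hx
  rw [map_sub, map_one, hφσ]
  simp

include hφσ hσ in
lemma hitL_eq_of_mem_Pcomp {m : ℕ} {i : Fin n} {D : Submodule k H} {x : H}
    (hx : x ∈ Pcomp k H π₀ m (block φ i) D) : hitL (σ (Pi.single i 1)) x = x := by
  have h1 : ∀ m, sliceL (σ m).ofConv (TensorProduct.map π₀ LinearMap.id (comulL k H x)) =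
      hitL (σ m) x := fun m => by
    rw [sliceL_map, show (σ m).ofConv ∘ₗ π₀ = (σ m).ofConv from
      LinearMap.ext (section_apply_proj hφσ hσ m)]
    rfl
  have h2 : (sliceL (σ 1).ofConv - sliceL (σ (Pi.single i 1)).ofConv : H ⊗[k] H →ₗ[k] H)
      (TensorProduct.map π₀ LinearMap.id (comulL k H x)) ∈ (⊥ : Submodule k H) := by
    refine map_mem_of_mem_tensorSM _ (fun y hy z _ => ?_) hx.1.2
    rw [LinearMap.sub_apply, sliceL_tmul, sliceL_tmul, ← sub_smul, map_one]
    have := one_sub_section_single_apply hφσ hy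
    change (1 : WithConv (H →ₗ[k] k)) y - σ (Pi.single i 1) y = 0 at this
    rw [Submodule.mem_bot, this, zero_smul]
  rw [LinearMap.sub_apply, h1, h1, Submodule.mem_bot, sub_eq_zero, map_one, hitL_one] at h2
  exact h2.symm

include hφσ hσ in
lemma hitR_eq_of_mem_Pcomp {m : ℕ} {i : Fin n} {D : Submodule k H} {x : H}
    (hx : x ∈ Pcomp k H π₀ m D (block φ i)) : hitR (σ (Pi.single i 1)) x = x := by
  have h1 : ∀ m, sliceR (σ m).ofConv (TensorProduct.map LinearMap.id π₀ (comulL k H x)) =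
      hitR (σ m) x := fun m => by
    rw [sliceR_map, show (σ m).ofConv ∘ₗ π₀ = (σ m).ofConv from
      LinearMap.ext (section_apply_proj hφσ hσ m)]
    rfl
  have h2 : (sliceR (σ 1).ofConv - sliceR (σ (Pi.single i 1)).ofConv : H ⊗[k] H →ₗ[k] H)
      (TensorProduct.map LinearMap.id π₀ (comulL k H x)) ∈ (⊥ : Submodule k H) := by
    refine map_mem_of_mem_tensorSM _ (fun z _ y hy => ?_) hx.2
    rw [LinearMap.sub_apply, sliceR_tmul, sliceR_tmul, ← sub_smul, map_one]
    have := one_sub_section_single_apply hφσ hy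
    change (1 : WithConv (H →ₗ[k] k)) y - σ (Pi.single i 1) y = 0 at this
    rw [Submodule.mem_bot, this, zero_smul]
  rw [LinearMap.sub_apply, h1, h1, Submodule.mem_bot, sub_eq_zero, map_one, hitR_one] at h2
  exact h2.symm

include hσ in
lemma mem_Pcomp_of_hit_eq {m : ℕ} {i j : Fin n} {x : H} (hx : x ∈ Pfilt k H π₀ m)
    (hL : hitL (σ (Pi.single i 1)) x = x) (hR : hitR (σ (Pi.single j 1)) x = x) :
    x ∈ Pcomp k H π₀ m (block φ i) (block φ j) := by
  refine ⟨⟨hx, mem_tensorSM_iff.2 ⟨fun b => ?_, fun _ => Submodule.mem_top⟩⟩,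
    mem_tensorSM_iff.2 ⟨fun _ => Submodule.mem_top, fun a => ?_⟩⟩
  · rw [LinearMap.comp_apply, sliceR_map]
    change π₀ (hitR (toConv b) x) ∈ _
    rw [← hL, ← hitL_hitR]
    refine mem_of_forall_apply_eq_zero fun f hf => ?_
    rw [← hσ, ← conv_apply_eq_hitL, ← map_mul]
    have : Pi.single i 1 * φ f = 0 := by
      ext l
      obtain rfl | hl := eq_or_ne l i
      · simp [(forall_mem_block_apply_eq_zero φ).1 hf]
      · simp [Pi.single_eq_of_ne hl]
    rw [this, map_zero]
    rfl
  · rw [LinearMap.comp_apply, sliceL_map]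
    change π₀ (hitL (toConv a) x) ∈ _
    rw [← hR, hitL_hitR]
    refine mem_of_forall_apply_eq_zero fun f hf => ?_
    rw [← hσ, ← conv_apply_eq_hitR, ← map_mul]
    have : φ f * Pi.single j 1 = 0 := by
      ext l
      obtain rfl | hl := eq_or_ne l j
      · simp [(forall_mem_block_apply_eq_zero φ).1 hf]
      · simp [Pi.single_eq_of_ne hl]
    rw [this, map_zero]
    rfl

end Section

section Exhaustion

open WithConv

variable {k : Type*} [Field k] {H : Type*} [AddCommGroup H] [Module k H] [Coalgebra k H]
  {n : ℕ} {d : Fin n → ℕ}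
  {φ : WithConv (H →ₗ[k] k) →ₐ[k] Π i, Matrix (Fin (d i)) (Fin (d i)) k}
  {π₀ : H →ₗ[k] H}

variable (φ) in
/-- The annihilator in `H` of the `m`-th power of the kernel of `φ`. -/
def radPerp (m : ℕ) : Submodule k H where
  carrier := {x | ∀ f ∈ (LinearMap.ker φ.toLinearMap) ^ m, f x = 0}
  add_mem' {x y} hx hy f hf := by rw [map_add, hx f hf, hy f hf, add_zero]
  zero_mem' f _ := map_zero f.ofConv
  smul_mem' c x hx f hf := by rw [map_smul, hx f hf, smul_zero]

lemma mul_mem_ker_pow_succ {m : ℕ} {f : WithConv (H →ₗ[k] k)}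
    (hf : f ∈ (LinearMap.ker φ.toLinearMap) ^ (m + 1)) (g : WithConv (H →ₗ[k] k)) :
    f * g ∈ (LinearMap.ker φ.toLinearMap) ^ (m + 1) := by
  rw [pow_succ] at hf ⊢
  induction hf using Submodule.mul_induction_on' with
  | mem_mul_mem u hu v hv =>
    rw [mul_assoc]
    refine Submodule.mul_mem_mul hu ?_
    change φ (v * g) = 0
    rw [map_mul, show φ v = 0 from hv, zero_mul]
  | add u _ v _ hu hv =>
    rw [add_mul]
    exact add_mem hu hv

lemma mul_mem_ker_pow_succ' {m : ℕ} {f : WithConv (H →ₗ[k] k)}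
    (hf : f ∈ (LinearMap.ker φ.toLinearMap) ^ (m + 1)) (g : WithConv (H →ₗ[k] k)) :
    g * f ∈ (LinearMap.ker φ.toLinearMap) ^ (m + 1) := by
  rw [pow_succ'] at hf ⊢
  induction hf using Submodule.mul_induction_on' with
  | mem_mul_mem u hu v hv =>
    rw [← mul_assoc]
    refine Submodule.mul_mem_mul ?_ hv
    change φ (g * u) = 0
    rw [map_mul, show φ u = 0 from hu, mul_zero]
  | add u _ v _ hu hv =>
    rw [mul_add]
    exact add_mem hu hv

lemma ker_pow_succ_le (m : ℕ) :
    (LinearMap.ker φ.toLinearMap) ^ (m + 1) ≤ LinearMap.ker φ.toLinearMap := by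
  induction m with
  | zero => rw [zero_add, pow_one]
  | succ m ih =>
    rw [pow_succ, Submodule.mul_le]
    intro u _ v hv
    simpa using mul_mem_ker_pow_succ' (m := 0) (by simpa using hv) u

lemma radPerp_succ_mono {m m' : ℕ} (h : m ≤ m') : radPerp φ (m + 1) ≤ radPerp φ (m' + 1) := by
  obtain ⟨l, rfl⟩ := Nat.exists_eq_add_of_le h
  intro x hx f hf
  refine hx f ?_
  clear h hx
  induction l with
  | zero => exact hf
  | succ l ih =>
    refine ih ?_
    rw [← add_assoc, pow_succ] at hf
    refine Submodule.mul_le.2 (fun u hu v _ => ?_) hf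
    exact mul_mem_ker_pow_succ hu v

lemma hitR_mem_radPerp {s t : ℕ} {f : WithConv (H →ₗ[k] k)}
    (hf : f ∈ (LinearMap.ker φ.toLinearMap) ^ s) {x : H} (hx : x ∈ radPerp φ (t + s)) :
    hitR f x ∈ radPerp φ t := fun g hg => by
  rw [← conv_apply_eq_hitR]
  refine hx _ ?_
  rw [pow_add]
  exact Submodule.mul_mem_mul hg hf

lemma hitR_mem_radPerp_succ (f : WithConv (H →ₗ[k] k)) {m : ℕ} {x : H}
    (hx : x ∈ radPerp φ (m + 1)) : hitR f x ∈ radPerp φ (m + 1) := fun g hg => by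
  rw [← conv_apply_eq_hitR]
  exact hx _ (mul_mem_ker_pow_succ hg f)

lemma hitL_mem_radPerp_succ (f : WithConv (H →ₗ[k] k)) {m : ℕ} {x : H}
    (hx : x ∈ radPerp φ (m + 1)) : hitL f x ∈ radPerp φ (m + 1) := fun g hg => by
  rw [← conv_apply_eq_hitL]
  exact hx _ (mul_mem_ker_pow_succ' hg f)

variable {σ : (Π i, Matrix (Fin (d i)) (Fin (d i)) k) →ₐ[k] WithConv (H →ₗ[k] k)}
  (hφσ : ∀ m, φ (σ m) = m) (hσ : ∀ f x, σ (φ f) x = f (π₀ x))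

include hσ in
lemma apply_proj_eq_zero {f : WithConv (H →ₗ[k] k)} (hf : φ f = 0) (x : H) : f (π₀ x) = 0 := by
  rw [← hσ, hf, map_zero]
  rfl

include hφσ in
lemma sub_section_mem_ker (f : WithConv (H →ₗ[k] k)) :
    f - σ (φ f) ∈ LinearMap.ker φ.toLinearMap := by
  change φ (f - σ (φ f)) = 0
  rw [map_sub, hφσ, sub_self]

include hφσ hσ in
lemma eq_proj_of_mem_radPerp_one {x : H} (hx : x ∈ radPerp φ 1) : x = π₀ x :=
  ext_conv fun f => by
    have := hx (f - σ (φ f)) ((pow_one (LinearMap.ker φ.toLinearMap)).symm ▸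
      sub_section_mem_ker hφσ f)
    change f x - σ (φ f) x = 0 at this
    rw [sub_eq_zero.1 this, hσ]

include hσ in
lemma sub_proj_mem_radPerp {m : ℕ} {x : H} (hx : x ∈ radPerp φ (m + 1)) :
    x - π₀ x ∈ radPerp φ (m + 1) := fun f hf => by
  rw [map_sub, hx f hf, apply_proj_eq_zero hσ (ker_pow_succ_le m hf), sub_zero]

include hφσ hσ in
lemma proj_proj (x : H) : π₀ (π₀ x) = π₀ x :=
  ext_conv fun f => by rw [← hσ, section_apply_proj hφσ hσ, hσ]

include hφσ hσ in
lemma sub_proj_mem_ker (x : H) : x - π₀ x ∈ LinearMap.ker π₀ := by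
  rw [LinearMap.mem_ker, map_sub, proj_proj hφσ hσ, sub_self]

include hσ in
lemma sliceR_map_id_sub (b : H →ₗ[k] k) (x : H) :
    sliceR b (TensorProduct.map (LinearMap.id - π₀) (LinearMap.id - π₀) (comulL k H x)) =
      (LinearMap.id - π₀ : H →ₗ[k] H) (hitR (toConv b - σ (φ (toConv b))) x) := by
  rw [sliceR_map]
  congr 1
  change _ = sliceR _ (comulL k H x)
  congr 2
  ext x
  change b (x - π₀ x) = b x - σ (φ (toConv b)) x
  rw [map_sub, hσ]

include hσ in
lemma sliceL_map_id_sub (a : H →ₗ[k] k) (x : H) :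
    sliceL a (TensorProduct.map (LinearMap.id - π₀) (LinearMap.id - π₀) (comulL k H x)) =
      (LinearMap.id - π₀ : H →ₗ[k] H) (hitL (toConv a - σ (φ (toConv a))) x) := by
  rw [sliceL_map]
  congr 1
  change _ = sliceL _ (comulL k H x)
  congr 2
  ext x
  change a (x - π₀ x) = a x - σ (φ (toConv a)) x
  rw [map_sub, hσ]

lemma map_id_sub_map_id_sub (hcoalg : TensorProduct.map π₀ π₀ ∘ₗ comulL k H = comulL k H ∘ₗ π₀)
    {x : H} (hx : π₀ x = 0) :
    TensorProduct.map (LinearMap.id - π₀) (LinearMap.id - π₀) (comulL k H x) =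
      (comulL k H - TensorProduct.map π₀ LinearMap.id ∘ₗ comulL k H -
        TensorProduct.map LinearMap.id π₀ ∘ₗ comulL k H) x := by
  have h := LinearMap.congr_fun hcoalg x
  rw [LinearMap.comp_apply, LinearMap.comp_apply, hx, map_zero] at h
  simp only [LinearMap.sub_apply, LinearMap.comp_apply]
  refine Eq.trans (b := _ + TensorProduct.map π₀ π₀ (comulL k H x)) ?_ (by rw [h, add_zero])
  generalize comulL k H x = t
  clear h
  induction t with
  | zero => simp
  | tmul x y =>
    simp only [TensorProduct.map_tmul, LinearMap.sub_apply, LinearMap.id_apply, sub_tmul, tmul_sub]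
    abel
  | add t u ht hu =>
    simp only [map_add, ht, hu]
    abel

include hφσ hσ in
/-- The elements of `ker π₀` killed by a power of the radical lie in Nichols' filtration. -/
lemma mem_Pfilt_of_mem_radPerp (hrange : LinearMap.range π₀ = coradical k H)
    (hcoalg : TensorProduct.map π₀ π₀ ∘ₗ comulL k H = comulL k H ∘ₗ π₀) (m : ℕ) {x : H}
    (hx0 : π₀ x = 0) (hx : x ∈ radPerp φ (m + 2)) : x ∈ Pfilt k H π₀ (m + 1) := by
  induction m using Nat.strong_induction_on generalizing x with
  | _ m ih =>
  match m, ih, hx with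
  | 0, _, hx =>
    have hcor : ∀ x, π₀ x ∈ coradical k H := fun x => hrange ▸ LinearMap.mem_range_self π₀ x
    rw [zero_add, Pfilt]
    refine ⟨hx0, ?_⟩
    have h1 : TensorProduct.map (LinearMap.id - π₀) (LinearMap.id - π₀) (comulL k H x) = 0 := by
      refine ext_sliceR fun b => ?_
      rw [sliceR_map_id_sub hσ, map_zero, LinearMap.sub_apply, sub_eq_zero]
      refine eq_proj_of_mem_radPerp_one hφσ hσ (hitR_mem_radPerp (s := 1) ?_ hx)
      rw [pow_one]
      exact sub_section_mem_ker hφσ _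
    rw [map_id_sub_map_id_sub hcoalg hx0, LinearMap.sub_apply, LinearMap.sub_apply, sub_sub,
      sub_eq_zero] at h1
    change comulL k H x ∈ tensorSM k H (coradical k H) (LinearMap.ker π₀) ⊔
      tensorSM k H (LinearMap.ker π₀) (coradical k H)
    rw [h1]
    refine add_mem (Submodule.mem_sup_left (mem_tensorSM_iff.2 ⟨fun b => ?_, fun a => ?_⟩))
      (Submodule.mem_sup_right (mem_tensorSM_iff.2 ⟨fun b => ?_, fun a => ?_⟩))
    · rw [LinearMap.comp_apply, sliceR_map]
      exact hcor _
    · rw [LinearMap.comp_apply, sliceL_map, show a ∘ₗ π₀ = (σ (φ (toConv a))).ofConv from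
        LinearMap.ext fun x => (hσ (toConv a) x).symm]
      change π₀ (hitL (σ _) x) = 0
      rw [← hitL_section_proj hφσ hσ, hx0, map_zero]
    · rw [LinearMap.comp_apply, sliceR_map, show b ∘ₗ π₀ = (σ (φ (toConv b))).ofConv from
        LinearMap.ext fun x => (hσ (toConv b) x).symm]
      change π₀ (hitR (σ _) x) = 0
      rw [← hitR_section_proj hφσ hσ, hx0, map_zero]
    · rw [LinearMap.comp_apply, sliceL_map]
      exact hcor _
  | m + 1, ih, hx =>
    rw [show m + 1 + 1 = m + 2 from rfl, Pfilt]
    refine ⟨hx0, ?_⟩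
    change _ ∈ (⨆ i : Fin (m + 1), tensorSM k H (Pfilt k H π₀ (i + 1)) (Pfilt k H π₀ (m + 1 - i)))
    rw [← map_id_sub_map_id_sub hcoalg hx0]
    set y := TensorProduct.map (LinearMap.id - π₀) (LinearMap.id - π₀) (comulL k H x) with hy
    let V : ℕ → Submodule k H := fun i => LinearMap.ker π₀ ⊓ radPerp φ (i + 1)
    have hV0 : ∀ z ∈ V 0, z = 0 := fun z hz =>
      (eq_proj_of_mem_radPerp_one hφσ hσ hz.2).trans hz.1
    have hVmono : ∀ {i j}, i ≤ j → V i ≤ V j := fun h =>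
      inf_le_inf_left _ (radPerp_succ_mono h)
    have hVsub : ∀ i, ∀ z ∈ radPerp φ (i + 1), (LinearMap.id - π₀ : H →ₗ[k] H) z ∈ V i :=
      fun i z hz => ⟨sub_proj_mem_ker hφσ hσ z, sub_proj_mem_radPerp hσ hz⟩
    have hyR : ∀ b, sliceR b y ∈ V (m + 1) := fun b => by
      rw [hy, sliceR_map_id_sub hσ]
      refine hVsub _ _ (hitR_mem_radPerp (s := 1) ?_ hx)
      rw [pow_one]
      exact sub_section_mem_ker hφσ _
    have hyR' : ∀ i, i ≤ m → ∀ b : H →ₗ[k] k,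
        toConv b ∈ (LinearMap.ker φ.toLinearMap) ^ (m + 1 - i + 1) → sliceR b y ∈ V i := by
      intro i hi b hb
      rw [hy, sliceR_map_id_sub hσ]
      have : φ (toConv b) = 0 := ker_pow_succ_le _ hb
      rw [this, map_zero, sub_zero]
      refine hVsub _ _ (hitR_mem_radPerp hb ?_)
      rwa [show i + 1 + (m + 1 - i + 1) = m + 1 + 2 by omega]
    choose r hrV hr using fun i => exists_projection (V i)
    have hsum : y = ∑ i ∈ Finset.range (m + 1),
        TensorProduct.map (r (i + 1) - r i) LinearMap.id y := by
      refine ext_sliceR fun b => ?_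
      rw [map_sum]
      simp only [sliceR_map, LinearMap.comp_id, LinearMap.sub_apply]
      rw [Finset.sum_range_sub (fun i => r i (sliceR b y)), hr _ _ (hyR b), hV0 _ (hrV 0 _),
        sub_zero]
    rw [hsum]
    refine sum_mem fun i hi => Submodule.mem_iSup_of_mem ⟨i, Finset.mem_range.1 hi⟩ ?_
    have him : i ≤ m := Nat.lt_succ_iff.1 (Finset.mem_range.1 hi)
    refine mem_tensorSM_iff.2 ⟨fun b => ?_, fun a => ?_⟩
    · rw [sliceR_map, LinearMap.comp_id]
      have : (r (i + 1) - r i) (sliceR b y) ∈ V (i + 1) :=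
        sub_mem (hrV _ _) (hVmono (Nat.le_succ i) (hrV _ _))
      exact ih i (Nat.lt_succ_iff.2 him) this.1 this.2
    · change _ ∈ Pfilt k H π₀ (m + 1 - i)
      rw [sliceL_map, LinearMap.id_apply, show m + 1 - i = m - i + 1 by omega]
      refine ih (m - i) (by omega) ?_ fun f hf => ?_
      · rw [hy, sliceL_map_id_sub hσ]
        exact sub_proj_mem_ker hφσ hσ _
      · rw [show f (sliceL (a ∘ₗ (r (i + 1) - r i)) y) =
          (a ∘ₗ (r (i + 1) - r i)) (sliceR f.ofConv y) from apply_sliceL _ _ _]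
        have h1 : sliceR f.ofConv y ∈ V i := hyR' i him _ (by
          rw [show m + 1 - i + 1 = m - i + 2 by omega]
          exact hf)
        rw [LinearMap.comp_apply, LinearMap.sub_apply, hr _ _ h1,
          hr _ _ (hVmono (Nat.le_succ i) h1), sub_self, map_zero]

end Exhaustion

section Mixed

open WithConv

lemma exists_apply_ne_zero_of_notMem {k : Type*} [Field k] {H : Type*} [AddCommGroup H]
    [Module k H] [FiniteDimensional k H] {W : Submodule k (WithConv (H →ₗ[k] k))}
    {f : WithConv (H →ₗ[k] k)} (hf : f ∉ W) : ∃ x : H, (∀ g ∈ W, g x = 0) ∧ f x ≠ 0 := by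
  obtain ⟨F, hF, hW⟩ := Submodule.exists_le_ker_of_notMem hf
  obtain ⟨x, hx⟩ := exists_forall_apply_eq F
  exact ⟨x, fun g hg => (hx g).trans (hW hg), fun h => hF ((hx f).symm.trans h)⟩

variable {k : Type*} [Field k] {H : Type*} [AddCommGroup H] [Module k H] [Coalgebra k H]
  [FiniteDimensional k H] {n : ℕ} {d : Fin n → ℕ}
  {φ : WithConv (H →ₗ[k] k) →ₐ[k] Π i, Matrix (Fin (d i)) (Fin (d i)) k}
  {π₀ : H →ₗ[k] H} {σ : (Π i, Matrix (Fin (d i)) (Fin (d i)) k) →ₐ[k] WithConv (H →ₗ[k] k)}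

omit [FiniteDimensional k H] in
lemma section_single_mul_self (i : Fin n) :
    σ (Pi.single i 1) * σ (Pi.single i 1) = σ (Pi.single i 1) := by
  rw [← map_mul, ← Pi.single_mul, one_mul]

omit [FiniteDimensional k H] in
lemma sum_section_single : ∑ i, σ (Pi.single i 1) = 1 := by
  rw [← map_sum, Finset.univ_sum_single (fun _ => 1)]
  exact map_one σ

variable (hφσ : ∀ m, φ (σ m) = m) (hσ : ∀ f x, σ (φ f) x = f (π₀ x))

include hφσ hσ in
lemma sub_proj_mem_Pcomp (hrange : LinearMap.range π₀ = coradical k H)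
    (hcoalg : TensorProduct.map π₀ π₀ ∘ₗ comulL k H = comulL k H ∘ₗ π₀) {m : ℕ} {i j : Fin n}
    {x : H} (hx : x ∈ radPerp φ (m + 2)) (hL : hitL (σ (Pi.single i 1)) x = x)
    (hR : hitR (σ (Pi.single j 1)) x = x) :
    x - π₀ x ∈ Pcomp k H π₀ (m + 1) (block φ i) (block φ j) := by
  refine mem_Pcomp_of_hit_eq hσ (mem_Pfilt_of_mem_radPerp hφσ hσ hrange hcoalg m
    (sub_proj_mem_ker hφσ hσ x) (sub_proj_mem_radPerp hσ hx)) ?_ ?_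
  · rw [map_sub, hitL_section_proj hφσ hσ, hL]
  · rw [map_sub, hitR_section_proj hφσ hσ, hR]

include hφσ hσ in
lemma mul_mul_mem_ker_sq_of_Pcomp_eq_bot (hrange : LinearMap.range π₀ = coradical k H)
    (hcoalg : TensorProduct.map π₀ π₀ ∘ₗ comulL k H = comulL k H ∘ₗ π₀) {i j : Fin n}
    (hP : Pcomp k H π₀ 1 (block φ i) (block φ j) = ⊥) {f : WithConv (H →ₗ[k] k)}
    (hf : φ f = 0) :
    σ (Pi.single i 1) * f * σ (Pi.single j 1) ∈ (LinearMap.ker φ.toLinearMap) ^ 2 := by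
  by_contra hcon
  obtain ⟨x, hx, hne⟩ := exists_apply_ne_zero_of_notMem hcon
  rw [conv_apply_eq_hitR, conv_apply_eq_hitL] at hne
  set z := hitL (σ (Pi.single i 1)) (hitR (σ (Pi.single j 1)) x) with hz
  have hzL : hitL (σ (Pi.single i 1)) z = z := by
    rw [hz, ← hitL_mul, section_single_mul_self]
  have hzR : hitR (σ (Pi.single j 1)) z = z := by
    rw [hz, ← hitL_hitR, ← hitR_mul, section_single_mul_self]
  have hz2 : z ∈ radPerp φ (0 + 2) := hitL_mem_radPerp_succ _ (hitR_mem_radPerp_succ _ hx)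
  have := sub_proj_mem_Pcomp hφσ hσ hrange hcoalg hz2 hzL hzR
  rw [zero_add, hP, Submodule.mem_bot, sub_eq_zero] at this
  rw [this, apply_proj_eq_zero hσ hf] at hne
  exact hne rfl

omit [FiniteDimensional k H] in
lemma mul_mul_mem_ker_pow {M : Fin n → Fin n → Prop} (hM : ∀ {i j}, M i j → ∀ l, M i l ∨ M l j)
    (hsq : ∀ {i j}, M i j → ∀ f, φ f = 0 →
      σ (Pi.single i 1) * f * σ (Pi.single j 1) ∈ (LinearMap.ker φ.toLinearMap) ^ 2)
    (m : ℕ) {i j : Fin n} (hij : M i j) {f : WithConv (H →ₗ[k] k)} (hf : φ f = 0) :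
    σ (Pi.single i 1) * f * σ (Pi.single j 1) ∈ (LinearMap.ker φ.toLinearMap) ^ (m + 1) := by
  induction m generalizing i j f with
  | zero => exact mul_mem_ker_pow_succ (mul_mem_ker_pow_succ' (by simpa using hf) _) _
  | succ m ih =>
    have h1 : ∀ g ∈ (LinearMap.ker φ.toLinearMap) ^ 2,
        σ (Pi.single i 1) * g * σ (Pi.single j 1) ∈ (LinearMap.ker φ.toLinearMap) ^ (m + 2) := by
      intro g hg
      rw [sq] at hg
      induction hg using Submodule.mul_induction_on' with
      | mem_mul_mem u hu v hv =>
        have h2 : σ (Pi.single i 1) * (u * v) * σ (Pi.single j 1) =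
            ∑ l, (σ (Pi.single i 1) * u * σ (Pi.single l 1)) *
              (σ (Pi.single l 1) * v * σ (Pi.single j 1)) := by
          have h3 : ∀ l, (σ (Pi.single i 1) * u * σ (Pi.single l 1)) *
              (σ (Pi.single l 1) * v * σ (Pi.single j 1)) =
              σ (Pi.single i 1) * u * σ (Pi.single l 1) * (v * σ (Pi.single j 1)) := fun l => by
            rw [mul_assoc (σ (Pi.single l 1)) v, mul_assoc _ (σ (Pi.single l 1)),
              ← mul_assoc (σ (Pi.single l 1)) (σ (Pi.single l 1)), section_single_mul_self,
              ← mul_assoc _ (σ (Pi.single l 1))]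
          rw [Finset.sum_congr rfl fun l _ => h3 l, ← Finset.sum_mul, ← Finset.mul_sum,
            sum_section_single, mul_one]
          simp only [mul_assoc]
        rw [h2]
        refine sum_mem fun l _ => ?_
        have hu' : ∀ a b, a * u * b ∈ (LinearMap.ker φ.toLinearMap) ^ (0 + 1) := fun a b =>
          mul_mem_ker_pow_succ (mul_mem_ker_pow_succ' (by simpa using hu) _) _
        have hv' : ∀ a b, a * v * b ∈ (LinearMap.ker φ.toLinearMap) ^ (0 + 1) := fun a b =>
          mul_mem_ker_pow_succ (mul_mem_ker_pow_succ' (by simpa using hv) _) _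
        rw [zero_add, pow_one] at hu' hv'
        obtain h | h := hM hij l
        · rw [pow_succ]
          exact Submodule.mul_mem_mul (ih h hu) (hv' _ _)
        · rw [pow_succ']
          exact Submodule.mul_mem_mul (hu' _ _) (ih h hv)
      | add u _ v _ hu hv =>
        rw [mul_add, add_mul]
        exact add_mem hu hv
    have h3 := h1 _ (hsq hij f hf)
    rwa [← mul_assoc, ← mul_assoc, section_single_mul_self, mul_assoc,
      section_single_mul_self] at h3

include hφσ hσ in
/-- If the degree-one components between blocks of size one and larger blocks vanish, then
the idempotents of the two kinds of blocks are orthogonal on the whole dual algebra. -/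
lemma mul_mul_eq_zero_of_Pcomp_one_eq_bot {N : ℕ} (hN : (LinearMap.ker φ.toLinearMap) ^ N = ⊥)
    (hrange : LinearMap.range π₀ = coradical k H)
    (hcoalg : TensorProduct.map π₀ π₀ ∘ₗ comulL k H = comulL k H ∘ₗ π₀)
    (hP : ∀ i j, ¬(d i = 1 ↔ d j = 1) → Pcomp k H π₀ 1 (block φ i) (block φ j) = ⊥)
    {i j : Fin n} (hij : ¬(d i = 1 ↔ d j = 1)) (f : WithConv (H →ₗ[k] k)) :
    σ (Pi.single i 1) * f * σ (Pi.single j 1) = 0 := by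
  have h1 := mul_mul_mem_ker_pow (σ := σ) (φ := φ) (M := fun i j => ¬(d i = 1 ↔ d j = 1))
    (fun h l => by tauto)
    (fun h f hf => mul_mul_mem_ker_sq_of_Pcomp_eq_bot hφσ hσ hrange hcoalg (hP _ _ h) hf)
    N hij (sub_section_mem_ker hφσ f)
  rw [pow_succ, hN, Submodule.bot_mul, Submodule.mem_bot, mul_sub, sub_mul, sub_eq_zero] at h1
  rw [h1, ← map_mul, ← map_mul]
  convert map_zero σ
  ext l : 1
  have hne : i ≠ j := fun h => hij (h ▸ Iff.rfl)
  obtain rfl | hl := eq_or_ne l i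
  · simp [Pi.single_eq_of_ne hne]
  · simp [Pi.single_eq_of_ne hl]

include hφσ hσ in
lemma Pcomp_eq_bot_of_mul_mul_eq_zero {i j : Fin n}
    (h : ∀ f, σ (Pi.single i 1) * f * σ (Pi.single j 1) = 0) (m : ℕ) :
    Pcomp k H π₀ m (block φ i) (block φ j) = ⊥ := by
  refine eq_bot_iff.2 fun x hx => (Submodule.mem_bot k).2 (ext_conv (k := k) fun f => ?_)
  rw [← hitL_eq_of_mem_Pcomp hφσ hσ hx, ← conv_apply_eq_hitL,
    ← hitR_eq_of_mem_Pcomp hφσ hσ hx, ← conv_apply_eq_hitR, h, map_zero]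
  rfl

end Mixed

section Pointed

open WithConv

variable {k : Type*} [Field k] {H : Type*} [AddCommGroup H] [Module k H] [Coalgebra k H]

omit [Coalgebra k H] in
lemma sum_conv_apply {ι : Type*} (s : Finset ι) (f : ι → WithConv (H →ₗ[k] k)) (x : H) :
    (∑ i ∈ s, f i) x = ∑ i ∈ s, f i x := by
  classical
  induction s using Finset.induction_on with
  | empty => rfl
  | insert a s ha ih =>
    rw [Finset.sum_insert ha, Finset.sum_insert ha, ← ih]
    rfl

/-- The elements of `H` fixed by the left action of a functional. -/
noncomputable def fixedPart (E : WithConv (H →ₗ[k] k)) : Submodule k H :=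
  LinearMap.eqLocus (hitL E) LinearMap.id

lemma hitR_eq_hitL_of_central {E : WithConv (H →ₗ[k] k)} (hE : ∀ a, E * a = a * E) (x : H) :
    hitR E x = hitL E x :=
  ext_conv fun a => by rw [← conv_apply_eq_hitR, ← conv_apply_eq_hitL, hE]

lemma hitL_mem_fixedPart {E : WithConv (H →ₗ[k] k)} (hE : ∀ a, E * a = a * E)
    (a : WithConv (H →ₗ[k] k)) {x : H} (hx : x ∈ fixedPart E) : hitL a x ∈ fixedPart E := by
  change hitL E (hitL a x) = hitL a x
  rw [← hitL_mul, ← hE, hitL_mul, show hitL E x = x from hx]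

lemma hitR_mem_fixedPart {E : WithConv (H →ₗ[k] k)} (a : WithConv (H →ₗ[k] k)) {x : H}
    (hx : x ∈ fixedPart E) : hitR a x ∈ fixedPart E := by
  change hitL E (hitR a x) = hitR a x
  rw [hitL_hitR, show hitL E x = x from hx]

variable {n : ℕ} {d : Fin n → ℕ}
  {φ : WithConv (H →ₗ[k] k) →ₐ[k] Π i, Matrix (Fin (d i)) (Fin (d i)) k}
  {π₀ : H →ₗ[k] H} {σ : (Π i, Matrix (Fin (d i)) (Fin (d i)) k) →ₐ[k] WithConv (H →ₗ[k] k)}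

variable (d k) in
/-- The sum of the identity matrices of the blocks of size one. -/
def unitBlocks (i : Fin n) : Matrix (Fin (d i)) (Fin (d i)) k := if d i = 1 then 1 else 0

lemma single_mul_unitBlocks (i : Fin n) :
    Pi.single i 1 * unitBlocks k d = if d i = 1 then Pi.single i 1 else 0 := by
  ext l : 1
  obtain rfl | hl := eq_or_ne l i
  · by_cases h : d l = 1 <;> simp [unitBlocks, h]
  · by_cases h : d i = 1 <;> simp [h, Pi.single_eq_of_ne hl]

lemma unitBlocks_mul_single (i : Fin n) :
    unitBlocks k d * Pi.single i 1 = if d i = 1 then Pi.single i 1 else 0 := by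
  ext l : 1
  obtain rfl | hl := eq_or_ne l i
  · by_cases h : d l = 1 <;> simp [unitBlocks, h]
  · by_cases h : d i = 1 <;> simp [h, Pi.single_eq_of_ne hl]

lemma unitBlocks_mul_self : unitBlocks k d * unitBlocks k d = unitBlocks k d := by
  ext i : 1
  by_cases h : d i = 1 <;> simp [unitBlocks, h]

lemma section_unitBlocks_central
    (h : ∀ {i j}, ¬(d i = 1 ↔ d j = 1) → ∀ f, σ (Pi.single i 1) * f * σ (Pi.single j 1) = 0)
    (f : WithConv (H →ₗ[k] k)) : σ (unitBlocks k d) * f = f * σ (unitBlocks k d) := by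
  have hsum : ∀ x : WithConv (H →ₗ[k] k),
      x = ∑ i, ∑ j, σ (Pi.single i 1) * x * σ (Pi.single j 1) := fun x => by
    simp_rw [← Finset.mul_sum, ← Finset.sum_mul, sum_section_single, one_mul, mul_one]
  rw [hsum (_ * f), hsum (f * _)]
  refine Finset.sum_congr rfl fun i _ => Finset.sum_congr rfl fun j _ => ?_
  rw [← mul_assoc, ← map_mul, single_mul_unitBlocks, ← mul_assoc,
    mul_assoc _ (σ (unitBlocks k d)) (σ (Pi.single j 1)), ← map_mul, unitBlocks_mul_single]
  by_cases hi : d i = 1 <;> by_cases hj : d j = 1 <;> simp only [hi, hj, if_true, if_false]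
  · rw [h (by tauto), map_zero, mul_zero]
  · rw [h (by tauto), map_zero, zero_mul, zero_mul]
  · rw [map_zero, mul_zero, zero_mul, zero_mul]

variable (hφσ : ∀ m, φ (σ m) = m) (hσ : ∀ f x, σ (φ f) x = f (π₀ x))

include hφσ in
lemma mem_fixedPart_of_mem_block [FiniteDimensional k H] {i : Fin n} (hi : d i = 1)
    {x : H} (hx : x ∈ block φ i) :
    x ∈ fixedPart (σ (unitBlocks k d)) := by
  change hitL _ x = x
  refine ext_conv (k := k) fun f => ?_
  rw [← conv_apply_eq_hitL, ← sub_eq_zero]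
  refine (forall_mem_block_apply_eq_zero φ (f := σ (unitBlocks k d) * f - f)).2 ?_ x hx
  rw [map_sub, map_mul, hφσ]
  simp [unitBlocks, hi]

lemma hitL_section_unitBlocks_of_hitL_eq {i : Fin n} (hi : d i = 1) {x : H}
    (hx : hitL (σ (Pi.single i 1)) x = x) : x ∈ fixedPart (σ (unitBlocks k d)) := by
  change hitL _ x = x
  rw [← hx, ← hitL_mul, ← map_mul, single_mul_unitBlocks, if_pos hi]

lemma hitL_section_single_eq_zero {i : Fin n} (hi : d i ≠ 1) {x : H}
    (hx : x ∈ fixedPart (σ (unitBlocks k d))) : hitL (σ (Pi.single i 1)) x = 0 := by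
  rw [← show hitL _ x = x from hx, ← hitL_mul, ← map_mul, unitBlocks_mul_single, if_neg hi,
    map_zero]
  exact ext_conv (k := k) fun f => by
    rw [← conv_apply_eq_hitL, zero_mul, map_zero]
    rfl

lemma sum_hitL_section_single (x : H) : ∑ i, hitL (σ (Pi.single i 1)) x = x :=
  ext_conv (k := k) fun f => by
    rw [map_sum]
    simp_rw [← conv_apply_eq_hitL]
    conv_rhs => rw [← one_mul f, ← sum_section_single (σ := σ), Finset.sum_mul]
    exact (sum_conv_apply _ _ _).symm

lemma sum_hitR_section_single (x : H) : ∑ i, hitR (σ (Pi.single i 1)) x = x :=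
  ext_conv (k := k) fun f => by
    rw [map_sum]
    simp_rw [← conv_apply_eq_hitR]
    conv_rhs => rw [← mul_one f, ← sum_section_single (σ := σ), Finset.mul_sum]
    exact (sum_conv_apply _ _ _).symm

include hσ in
lemma proj_mem_block_of_hitL_eq [FiniteDimensional k H] {i : Fin n} {x : H}
    (hx : hitL (σ (Pi.single i 1)) x = x) : π₀ x ∈ block φ i := by
  refine mem_of_forall_apply_eq_zero fun f hf => ?_
  rw [← hσ, ← hx, ← conv_apply_eq_hitL, ← map_mul]
  convert LinearMap.zero_apply (M₂ := k) (σ₁₂ := RingHom.id k) x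
  have : Pi.single i 1 * φ f = 0 := by
    ext l
    obtain rfl | hl := eq_or_ne l i
    · simp [(forall_mem_block_apply_eq_zero φ).1 hf]
    · simp [Pi.single_eq_of_ne hl]
  rw [this, map_zero]
  rfl

end Pointed

section PointedPart

open WithConv

variable {k : Type*} [Field k] {H : Type*} [AddCommGroup H] [Module k H] [Coalgebra k H]
  [FiniteDimensional k H] {n : ℕ} {d : Fin n → ℕ}
  {φ : WithConv (H →ₗ[k] k) →ₐ[k] Π i, Matrix (Fin (d i)) (Fin (d i)) k}
  {π₀ : H →ₗ[k] H} {σ : (Π i, Matrix (Fin (d i)) (Fin (d i)) k) →ₐ[k] WithConv (H →ₗ[k] k)}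
  {N : ℕ}

omit [FiniteDimensional k H] in
lemma mem_radPerp_of_le (hN : (LinearMap.ker φ.toLinearMap) ^ N = ⊥) {m : ℕ} (hm : N ≤ m) (x : H) :
    x ∈ radPerp φ m := fun f hf => by
  obtain ⟨l, rfl⟩ := Nat.exists_eq_add_of_le hm
  rw [pow_add, hN, Submodule.bot_mul, Submodule.mem_bot] at hf
  rw [hf]
  rfl

lemma block_le_span_grouplikes (hφ : Function.Surjective φ) {i : Fin n} (hi : d i = 1) :
    block φ i ≤ Submodule.span k (grouplikes k H) := by
  obtain ⟨g, hg, h⟩ := exists_isGrouplike_span_eq_block hφ hi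
  rw [← h]
  exact Submodule.span_mono (Set.singleton_subset_iff.2 hg)

variable (hφ : Function.Surjective φ) (hφσ : ∀ m, φ (σ m) = m)
  (hσ : ∀ f x, σ (φ f) x = f (π₀ x))

include hφ hσ in
lemma proj_mem_span_grouplikes {x : H} (hx : x ∈ fixedPart (σ (unitBlocks k d))) :
    π₀ x ∈ Submodule.span k (grouplikes k H) := by
  rw [← sum_hitL_section_single (σ := σ) x, map_sum]
  refine sum_mem fun i _ => ?_
  by_cases hi : d i = 1
  · refine block_le_span_grouplikes hφ hi (proj_mem_block_of_hitL_eq hσ ?_)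
    rw [← hitL_mul, section_single_mul_self]
  · rw [hitL_section_single_eq_zero hi hx, map_zero]
    exact zero_mem _

include hφ hφσ hσ in
/-- A convolution idempotent vanishing on the grouplikes vanishes on the pointed part. -/
lemma eq_zero_of_idempotent_of_mem_fixedPart (hN : (LinearMap.ker φ.toLinearMap) ^ N = ⊥)
    (hcen : ∀ a, σ (unitBlocks k d) * a = a * σ (unitBlocks k d))
    {X : Type*} [Ring X] [Algebra k X] {Ψ : WithConv (H →ₗ[k] X)} (hΨ : Ψ * Ψ = Ψ)
    (h0 : ∀ g ∈ grouplikes k H, Ψ g = 0) {x : H} (hx : x ∈ fixedPart (σ (unitBlocks k d))) :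
    Ψ x = 0 := by
  have key : ∀ m, ∀ x ∈ fixedPart (σ (unitBlocks k d)), x ∈ radPerp φ (m + 1) → Ψ x = 0 := by
    intro m
    induction m with
    | zero =>
      intro x hx hxm
      have h1 := proj_mem_span_grouplikes hφ hσ hx
      rw [← eq_proj_of_mem_radPerp_one hφσ hσ hxm] at h1
      exact (Submodule.span_le.2 h0 : _ ≤ LinearMap.ker Ψ.ofConv) h1
    | succ m ih =>
      intro x hx hxm
      have h1 : TensorProduct.map Ψ.ofConv Ψ.ofConv (comulL k H x) = 0 := by
        refine ext_sliceR fun c => ?_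
        rw [sliceR_map, map_zero]
        change Ψ (hitR (toConv (c ∘ₗ Ψ.ofConv)) x) = 0
        rw [← show hitL _ x = x from hx, ← hitR_eq_hitL_of_central hcen, ← hitR_mul]
        refine ih _ (hitR_mem_fixedPart _ hx) (hitR_mem_radPerp (s := 1) ?_ hxm)
        rw [pow_one]
        change φ (_ * _) = 0
        rw [map_mul, hφσ]
        ext i : 1
        by_cases hi : d i = 1
        · have : φ (toConv (c ∘ₗ Ψ.ofConv)) i = 0 := by
            refine (forall_mem_block_apply_eq_zero φ).1 fun y hy => ?_
            have h2 : Ψ y = 0 := (Submodule.span_le.2 h0 : _ ≤ LinearMap.ker Ψ.ofConv)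
              (block_le_span_grouplikes hφ hi hy)
            change c (Ψ y) = 0
            rw [h2, map_zero]
          simp [this]
        · simp [unitBlocks, hi]
      rw [← hΨ, LinearMap.convMul_apply]
      change LinearMap.mul' k X (TensorProduct.map Ψ.ofConv Ψ.ofConv (comulL k H x)) = 0
      rw [h1, map_zero]
  exact key N x hx (mem_radPerp_of_le hN (Nat.le_succ N) x)

include hφ hφσ hσ in
lemma iSup_Pcomp_sup_span_eq_fixedPart [∀ i, NeZero (d i)]
    (hN : (LinearMap.ker φ.toLinearMap) ^ N = ⊥)
    (hrange : LinearMap.range π₀ = coradical k H)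
    (hcoalg : TensorProduct.map π₀ π₀ ∘ₗ comulL k H = comulL k H ∘ₗ π₀)
    (hcen : ∀ a, σ (unitBlocks k d) * a = a * σ (unitBlocks k d)) :
    (⨆ g ∈ grouplikes k H, ⨆ h ∈ grouplikes k H,
      ⨆ n, Pcomp k H π₀ n (Submodule.span k {g}) (Submodule.span k {h})) ⊔
        Submodule.span k (grouplikes k H) = fixedPart (σ (unitBlocks k d)) := by
  refine le_antisymm (sup_le ?_ ?_) ?_
  · refine iSup₂_le fun g hg => iSup₂_le fun h hh => iSup_le fun m => ?_
    obtain ⟨i, hi, hgi⟩ := exists_span_eq_block_of_isGrouplike hφ hN hg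
    rw [hgi]
    exact fun x hx => hitL_section_unitBlocks_of_hitL_eq hi (hitL_eq_of_mem_Pcomp hφσ hσ hx)
  · refine Submodule.span_le.2 fun g hg => ?_
    obtain ⟨i, hi, hgi⟩ := exists_span_eq_block_of_isGrouplike hφ hN hg
    exact mem_fixedPart_of_mem_block hφσ hi (hgi ▸ Submodule.mem_span_singleton_self g)
  · intro x hx
    rw [← sum_hitL_section_single (σ := σ) x]
    refine sum_mem fun i _ => ?_
    by_cases hi : d i = 1
    swap
    · rw [hitL_section_single_eq_zero hi hx]
      exact zero_mem _
    rw [← sum_hitR_section_single (σ := σ) (hitL _ x)]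
    refine sum_mem fun j _ => ?_
    rw [← hitL_hitR]
    by_cases hj : d j = 1
    swap
    · have h0 : hitR (σ (Pi.single j 1)) x = 0 := by
        rw [← show hitL _ x = x from hx, ← hitR_eq_hitL_of_central hcen, ← hitR_mul, ← map_mul,
          single_mul_unitBlocks, if_neg hj, map_zero]
        exact ext_conv (k := k) fun f => by
          rw [← conv_apply_eq_hitR, mul_zero, map_zero]
          rfl
      rw [h0, map_zero]
      exact zero_mem _
    set z := hitL (σ (Pi.single i 1)) (hitR (σ (Pi.single j 1)) x) with hz
    have hzL : hitL (σ (Pi.single i 1)) z = z := by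
      rw [hz, ← hitL_mul, section_single_mul_self]
    have hzR : hitR (σ (Pi.single j 1)) z = z := by
      rw [hz, ← hitL_hitR, ← hitR_mul, section_single_mul_self]
    have hzQ := hitL_section_unitBlocks_of_hitL_eq hi hzL
    obtain ⟨g, hg, hgi⟩ := exists_isGrouplike_span_eq_block hφ hi
    obtain ⟨h, hh, hhj⟩ := exists_isGrouplike_span_eq_block hφ hj
    rw [← sub_add_cancel z (π₀ z)]
    refine add_mem (Submodule.mem_sup_left ?_) (Submodule.mem_sup_right
      (proj_mem_span_grouplikes hφ hσ hzQ))
    have := sub_proj_mem_Pcomp hφσ hσ hrange hcoalg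
      (mem_radPerp_of_le hN (Nat.le_add_right N 2) z) hzL hzR
    rw [← hgi, ← hhj] at this
    exact Submodule.mem_iSup_of_mem g (Submodule.mem_iSup_of_mem hg (Submodule.mem_iSup_of_mem h
      (Submodule.mem_iSup_of_mem hh (Submodule.mem_iSup_of_mem (N + 1) this))))

end PointedPart

section Multiplication

open WithConv

variable {k : Type*} [Field k] {H : Type*} [Ring H] [Bialgebra k H]

/-- The map `x ↦ (y ↦ F (x y))`. -/
noncomputable def mulConv (F : WithConv (H →ₗ[k] k)) : WithConv (H →ₗ[k] WithConv (H →ₗ[k] k)) :=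
  toConv ((WithConv.linearEquiv k (H →ₗ[k] k)).symm.toLinearMap ∘ₗ
    (LinearMap.llcomp k H H k F.ofConv) ∘ₗ LinearMap.mul k H)

lemma mulConv_apply (F : WithConv (H →ₗ[k] k)) (x y : H) : mulConv F x y = F (x * y) := rfl

lemma mulConv_mul (F G : WithConv (H →ₗ[k] k)) : mulConv (F * G) = mulConv F * mulConv G := by
  ext x y
  rw [(Coalgebra.Repr.arbitrary k x).convMul_apply]
  change (F * G) (x * y) = (∑ i ∈ _, _ : WithConv (H →ₗ[k] k)) y
  rw [sum_conv_apply, LinearMap.convMul_apply, Bialgebra.comul_mul]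
  simp_rw [(Coalgebra.Repr.arbitrary k y).convMul_apply]
  conv_lhs => rw [← (Coalgebra.Repr.arbitrary k x).eq, ← (Coalgebra.Repr.arbitrary k y).eq]
  simp only [Finset.sum_mul_sum, map_sum, Algebra.TensorProduct.tmul_mul_tmul,
    TensorProduct.map_tmul, LinearMap.mul'_apply]
  rfl

variable [FiniteDimensional k H] {n : ℕ} {d : Fin n → ℕ}
  {φ : WithConv (H →ₗ[k] k) →ₐ[k] Π i, Matrix (Fin (d i)) (Fin (d i)) k}
  {π₀ : H →ₗ[k] H} {σ : (Π i, Matrix (Fin (d i)) (Fin (d i)) k) →ₐ[k] WithConv (H →ₗ[k] k)}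
  {N : ℕ}

omit [FiniteDimensional k H] in
lemma one_sub_apply_eq_zero_of_mem_fixedPart {E : WithConv (H →ₗ[k] k)} {x : H}
    (hx : x ∈ fixedPart E) : (1 - E) x = 0 := by
  change (1 : WithConv (H →ₗ[k] k)) x - E x = 0
  conv_lhs => rw [← mul_one E, conv_apply_eq_hitL, show hitL E x = x from hx, sub_self]

variable (hφ : Function.Surjective φ) (hφσ : ∀ m, φ (σ m) = m)
  (hσ : ∀ f x, σ (φ f) x = f (π₀ x))

include hφ hφσ in
lemma mem_fixedPart_of_comul_eq [∀ i, NeZero (d i)]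
    (hN : (LinearMap.ker φ.toLinearMap) ^ N = ⊥) {g : H} (hg : comulL k H g = g ⊗ₜ[k] g) :
    g ∈ fixedPart (σ (unitBlocks k d)) := by
  obtain rfl | h0 := eq_or_ne g 0
  · exact zero_mem _
  obtain ⟨i, hi, hgi⟩ := exists_span_eq_block_of_isGrouplike hφ hN
    (show g ∈ grouplikes k H from ⟨h0, hg⟩)
  exact mem_fixedPart_of_mem_block hφσ hi (hgi ▸ Submodule.mem_span_singleton_self g)

include hφ hφσ hσ in
lemma one_sub_apply_mul_eq_zero [∀ i, NeZero (d i)]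
    (hN : (LinearMap.ker φ.toLinearMap) ^ N = ⊥)
    (hcen : ∀ a, σ (unitBlocks k d) * a = a * σ (unitBlocks k d)) {x y : H}
    (hx : x ∈ fixedPart (σ (unitBlocks k d))) (hy : y ∈ fixedPart (σ (unitBlocks k d))) :
    (1 - σ (unitBlocks k d)) (x * y) = 0 := by
  set E := σ (unitBlocks k d) with hE
  have hEE : E * E = E := by rw [hE, ← map_mul, unitBlocks_mul_self]
  have hFF : (1 - E) * (1 - E) = 1 - E := by
    rw [mul_sub, sub_mul, sub_mul, hEE, one_mul, mul_one, one_mul, sub_self, sub_zero]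
  have hmul : mulConv (1 - E) * mulConv (1 - E) = mulConv (1 - E) := by rw [← mulConv_mul, hFF]
  have hEQ : ∀ z, hitL E z ∈ fixedPart E := fun z => by
    change hitL E (hitL E z) = hitL E z
    rw [← hitL_mul, hEE]
  have h1 : ∀ g ∈ grouplikes k H, ∀ z ∈ fixedPart E, mulConv (1 - E) g z = 0 := by
    intro g hg z hz
    refine eq_zero_of_idempotent_of_mem_fixedPart hφ hφσ hσ hN hcen ?_ (fun h hh => ?_) hz
    · conv_rhs => rw [← hmul]
      rw [LinearMap.convMul_apply, show Coalgebra.comul g = g ⊗ₜ[k] g from hg.2]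
      rfl
    · refine one_sub_apply_eq_zero_of_mem_fixedPart (mem_fixedPart_of_comul_eq hφ hφσ hN ?_)
      change Coalgebra.comul (g * h) = _
      rw [Bialgebra.comul_mul, show Coalgebra.comul g = g ⊗ₜ[k] g from hg.2,
        show Coalgebra.comul h = h ⊗ₜ[k] h from hh.2, Algebra.TensorProduct.tmul_mul_tmul]
      rfl
  have h2 : E * mulConv (1 - E) x = 0 := by
    refine eq_zero_of_idempotent_of_mem_fixedPart hφ hφσ hσ hN hcen
      (Ψ := toConv (LinearMap.mulLeft k E ∘ₗ (mulConv (1 - E)).ofConv)) ?_ (fun g hg => ?_) hx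
    · ext1
      refine LinearMap.ext fun z => ?_
      change _ = E * mulConv (1 - E) z
      conv_rhs => rw [← hmul]
      rw [(Coalgebra.Repr.arbitrary k z).convMul_apply,
        (Coalgebra.Repr.arbitrary k z).convMul_apply, Finset.mul_sum]
      refine Finset.sum_congr rfl fun i _ => ?_
      change E * mulConv (1 - E) _ * (E * mulConv (1 - E) _) = _
      rw [mul_assoc, ← mul_assoc _ E, ← hcen, mul_assoc E, ← mul_assoc E E, hEE]
    · refine WithConv.ext (LinearMap.ext fun z => ?_)
      change (E * mulConv (1 - E) g : WithConv (H →ₗ[k] k)) z = 0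
      rw [conv_apply_eq_hitL]
      exact h1 g hg _ (hEQ z)
  rw [← mulConv_apply, ← show hitL E y = y from hy, ← conv_apply_eq_hitL, h2]
  rfl

include hφ hφσ hσ in
lemma mul_mem_fixedPart [∀ i, NeZero (d i)]
    (hN : (LinearMap.ker φ.toLinearMap) ^ N = ⊥)
    (hcen : ∀ a, σ (unitBlocks k d) * a = a * σ (unitBlocks k d)) {x y : H}
    (hx : x ∈ fixedPart (σ (unitBlocks k d))) (hy : y ∈ fixedPart (σ (unitBlocks k d))) :
    x * y ∈ fixedPart (σ (unitBlocks k d)) := by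
  set E := σ (unitBlocks k d) with hE
  have hsub : IsSubcoalgWrt k (comulL k H) (fixedPart E) :=
    isSubcoalg_of_forall_hit_mem (fun f _ h => hitL_mem_fixedPart hcen f h)
      (fun f _ h => hitR_mem_fixedPart f h)
  refine ext_conv (k := k) fun a => ?_
  rw [LinearMap.id_apply, ← conv_apply_eq_hitL, eq_comm, ← sub_eq_zero]
  have h1 : ((1 - E) * a) (x * y) = 0 := by
    rw [LinearMap.convMul_apply, Bialgebra.comul_mul, ← Submodule.mem_bot k]
    refine map_mem_of_mem_tensorSM (LinearMap.mul' k k ∘ₗ TensorProduct.map (1 - E).ofConv a.ofConv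
      ∘ₗ LinearMap.mulRight k (comulL k H y)) (fun x₁ hx₁ x₂ _ => ?_) (hsub x hx)
    refine map_mem_of_mem_tensorSM (LinearMap.mul' k k ∘ₗ TensorProduct.map (1 - E).ofConv a.ofConv
      ∘ₗ LinearMap.mulLeft k (x₁ ⊗ₜ[k] x₂)) (fun y₁ hy₁ y₂ _ => ?_) (hsub y hy)
    simp only [LinearMap.comp_apply, LinearMap.mulLeft_apply, Algebra.TensorProduct.tmul_mul_tmul,
      TensorProduct.map_tmul, LinearMap.mul'_apply]
    rw [one_sub_apply_mul_eq_zero hφ hφσ hσ hN hcen hx₁ hy₁, zero_mul]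
    exact zero_mem _
  rw [← h1, sub_mul, one_mul]
  rfl

include hφ hφσ hσ in
/-- The pointed part contains every Taft subalgebra, and coincides with it when it is proper and
the dimension is `p ^ 3`. -/
lemma fixedPart_eq_of_isTaftSubalgebra [∀ i, NeZero (d i)]
    (hN : (LinearMap.ker φ.toLinearMap) ^ N = ⊥)
    (hcen : ∀ a, σ (unitBlocks k d) * a = a * σ (unitBlocks k d))
    (hdvd : ∀ B : Subalgebra k H, (∀ x ∈ B, comulL k H x ∈
      tensorSM k H (Subalgebra.toSubmodule B) (Subalgebra.toSubmodule B)) →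
      Module.finrank k B ∣ Module.finrank k H)
    {p : ℕ} (hp : p.Prime) (hdim : Module.finrank k H = p ^ 3)
    (hne : fixedPart (σ (unitBlocks k d)) ≠ ⊤) {q : k} {T : Subalgebra k H}
    (hT : IsTaftSubalgebra k p q T) :
    fixedPart (σ (unitBlocks k d)) = Subalgebra.toSubmodule T := by
  set E := σ (unitBlocks k d) with hE
  have hone : (1 : H) ∈ fixedPart E := mem_fixedPart_of_comul_eq hφ hφσ hN (by
    change Coalgebra.comul (1 : H) = _
    rw [Bialgebra.comul_one, Algebra.TensorProduct.one_def])
  let B : Subalgebra k H := (fixedPart E).toSubalgebra hone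
    fun x y hx hy => mul_mem_fixedPart hφ hφσ hσ hN hcen hx hy
  have hsub : ∀ x ∈ B, comulL k H x ∈
      tensorSM k H (Subalgebra.toSubmodule B) (Subalgebra.toSubmodule B) :=
    isSubcoalg_of_forall_hit_mem (D := fixedPart E) (fun f _ h => hitL_mem_fixedPart hcen f h)
      (fun f _ h => hitR_mem_fixedPart f h)
  obtain ⟨-, hTdim, g, x, hg, hx, -, -, -, hgen⟩ := hT
  have hFg : (1 - E) g = 0 :=
    one_sub_apply_eq_zero_of_mem_fixedPart (mem_fixedPart_of_comul_eq hφ hφσ hN hg.2)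
  have hF1 : (1 - E) (1 : H) = 0 := one_sub_apply_eq_zero_of_mem_fixedPart hone
  have hTB : T ≤ B := by
    rw [← hgen]
    refine Algebra.adjoin_le ?_
    rintro y (rfl | rfl)
    · exact mem_fixedPart_of_comul_eq hφ hφσ hN hg.2
    · have hF : hitL (1 - E) y = (1 - E) y • (1 : H) := by
        rw [hitL, LinearMap.comp_apply]
        erw [hx]
        rw [map_add, sliceL_tmul, sliceL_tmul, hFg, zero_smul, add_zero]
      have hFF : (1 - E) * (1 - E) = 1 - E := by
        rw [mul_sub, sub_mul, sub_mul, hE, ← map_mul, unitBlocks_mul_self, one_mul, mul_one,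
          one_mul, sub_self, sub_zero]
      have h0 : (1 - E) y = 0 := by
        rw [← hFF, conv_apply_eq_hitL, hF, map_smul, hF1, smul_zero]
      rw [h0, zero_smul] at hF
      change hitL E y = y
      refine ext_conv (k := k) fun a => ?_
      rw [← conv_apply_eq_hitL, eq_comm, ← sub_eq_zero]
      change (a - E * a) y = 0
      rw [← one_sub_mul, conv_apply_eq_hitL, hF, map_zero]
  have hle : p ^ 2 ≤ Module.finrank k B := by
    rw [← hTdim]
    exact Submodule.finrank_mono (s := Subalgebra.toSubmodule T) (t := Subalgebra.toSubmodule B) hTB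
  have hBdim : Module.finrank k B = p ^ 2 := by
    have h1 := hdvd B hsub
    rw [hdim] at h1
    obtain ⟨i, hi, h2⟩ := (Nat.dvd_prime_pow hp).1 h1
    have h3 : 2 ≤ i := (Nat.pow_le_pow_iff_right hp.one_lt).1 (h2 ▸ hle)
    have h4 : i ≠ 3 := by
      rintro rfl
      exact hne (Submodule.eq_top_of_finrank_eq (h2.trans hdim.symm))
    rw [h2, show i = 2 by omega]
  exact (Submodule.eq_of_le_of_finrank_eq (S₁ := Subalgebra.toSubmodule T)
    (S₂ := Subalgebra.toSubmodule B) hTB (hTdim.trans hBdim.symm)).symm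

end Multiplication

section Rank

open WithConv

lemma finrank_range_sum_of_isIdempotentElem {k : Type*} [Field k] [CharZero k] {M : Type*}
    [AddCommGroup M] [Module k M] [FiniteDimensional k M] {ι : Type*} (s : Finset ι)
    {P : ι → Module.End k M} (hP : ∀ i ∈ s, IsIdempotentElem (P i))
    (hsum : IsIdempotentElem (∑ i ∈ s, P i)) :
    Module.finrank k (LinearMap.range (∑ i ∈ s, P i)) =
      ∑ i ∈ s, Module.finrank k (LinearMap.range (P i)) := by
  have key : ∀ f : Module.End k M, IsIdempotentElem f →
      (Module.finrank k (LinearMap.range f) : k) = LinearMap.trace k M f := fun f hf =>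
    (LinearMap.IsIdempotentElem.isProj_range f hf).trace.symm
  have h : (Module.finrank k (LinearMap.range (∑ i ∈ s, P i)) : k) =
      ((∑ i ∈ s, Module.finrank k (LinearMap.range (P i)) : ℕ) : k) := by
    rw [key _ hsum, map_sum, Nat.cast_sum]
    exact Finset.sum_congr rfl fun i hi => (key _ (hP i hi)).symm
  exact_mod_cast h

variable {k : Type*} [Field k] {H : Type*} [AddCommGroup H] [Module k H] [Coalgebra k H]

lemma hitL_sum {ι : Type*} (s : Finset ι) (f : ι → WithConv (H →ₗ[k] k)) (x : H) :
    hitL (∑ i ∈ s, f i) x = ∑ i ∈ s, hitL (f i) x :=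
  ext_conv (k := k) fun a => by
    rw [map_sum, ← conv_apply_eq_hitL, Finset.sum_mul, sum_conv_apply]
    simp_rw [← conv_apply_eq_hitL]

lemma hitR_sum {ι : Type*} (s : Finset ι) (f : ι → WithConv (H →ₗ[k] k)) (x : H) :
    hitR (∑ i ∈ s, f i) x = ∑ i ∈ s, hitR (f i) x :=
  ext_conv (k := k) fun a => by
    rw [map_sum, ← conv_apply_eq_hitR, Finset.mul_sum, sum_conv_apply]
    simp_rw [← conv_apply_eq_hitR]

lemma hitL_zero (x : H) : hitL (0 : WithConv (H →ₗ[k] k)) x = 0 := by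
  simpa using hitL_sum (∅ : Finset ℕ) (fun _ => (0 : WithConv (H →ₗ[k] k))) x

lemma hitR_zero (x : H) : hitR (0 : WithConv (H →ₗ[k] k)) x = 0 := by
  simpa using hitR_sum (∅ : Finset ℕ) (fun _ => (0 : WithConv (H →ₗ[k] k))) x

lemma sum_hitL_hitR {ι κ : Type*} [Fintype ι] [Fintype κ] (a : ι → WithConv (H →ₗ[k] k))
    (b : κ → WithConv (H →ₗ[k] k)) (x : H) :
    ∑ u : ι × κ, hitL (a u.1) (hitR (b u.2) x) = hitL (∑ i, a i) (hitR (∑ j, b j) x) := by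
  rw [Fintype.sum_prod_type, hitL_sum]
  exact Finset.sum_congr rfl fun i _ => by rw [hitR_sum, map_sum]

variable [FiniteDimensional k H] {n : ℕ} {d : Fin n → ℕ}
  {σ : (Π i, Matrix (Fin (d i)) (Fin (d i)) k) →ₐ[k] WithConv (H →ₗ[k] k)}

omit [Coalgebra k H] [FiniteDimensional k H] in
lemma single_one_eq_sum_blockUnit (i : Fin n) :
    (Pi.single i 1 : Π i, Matrix (Fin (d i)) (Fin (d i)) k) = ∑ a, blockUnit i a a := by
  simp_rw [blockUnit, ← Matrix.sum_single_one]
  exact map_sum (AddMonoidHom.single (fun i => Matrix (Fin (d i)) (Fin (d i)) k) i) _ _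

lemma finrank_range_hitL_comp_hitR [∀ i, NeZero (d i)] (i j : Fin n) :
    Module.finrank k (LinearMap.range
        (hitL (σ (Pi.single i 1)) ∘ₗ hitR (σ (Pi.single j 1)))) =
      d i * (d j * Module.finrank k (LinearMap.range
        (hitL (σ (blockUnit i 0 0)) ∘ₗ hitR (σ (blockUnit j 0 0))))) := by
  have hL := finrank_range_sum_matrixUnit
    (fun a b => hitL (σ (blockUnit i b a)) ∘ₗ hitR (σ (Pi.single j 1))) (fun a b c e x => by
      simp only [LinearMap.comp_apply]
      rw [← hitL_hitR, ← hitR_mul, ← map_mul, ← Pi.single_mul, one_mul, ← hitL_mul, ← map_mul,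
        blockUnit_mul_same]
      by_cases h : b = c
      · rw [if_pos h.symm, if_pos h]
      · rw [if_neg (Ne.symm h), if_neg h, map_zero, hitL_zero]) 0
  have hR := finrank_range_sum_matrixUnit
    (fun a b => hitL (σ (blockUnit i 0 0)) ∘ₗ hitR (σ (blockUnit j a b))) (fun a b c e x => by
      simp only [LinearMap.comp_apply]
      rw [← hitL_hitR, ← hitR_mul, ← map_mul, ← hitL_mul, ← map_mul, blockUnit_mul_same,
        blockUnit_mul_same, if_pos rfl]
      by_cases h : b = c
      · rw [if_pos h, if_pos h]
      · rw [if_neg h, if_neg h, map_zero, hitR_zero, map_zero]) 0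
  rw [← hR, show hitL (σ (Pi.single i 1)) ∘ₗ hitR (σ (Pi.single j 1)) =
      ∑ a, hitL (σ (blockUnit i a a)) ∘ₗ hitR (σ (Pi.single j 1)) from LinearMap.ext fun x => by
        simp only [LinearMap.sum_apply, LinearMap.comp_apply]
        rw [single_one_eq_sum_blockUnit i, map_sum, hitL_sum]]
  refine hL.trans ?_
  rw [show hitL (σ (blockUnit i 0 0)) ∘ₗ hitR (σ (Pi.single j 1)) =
      ∑ a, hitL (σ (blockUnit i 0 0)) ∘ₗ hitR (σ (blockUnit j a a)) from LinearMap.ext fun x => by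
        simp only [LinearMap.sum_apply, LinearMap.comp_apply]
        rw [single_one_eq_sum_blockUnit j, map_sum, hitR_sum, map_sum]]

/-- If the large blocks have sizes divisible by `δ`, then the complement of the pointed part has
dimension divisible by `δ ^ 2`. -/
lemma sq_dvd_finrank_range_hitL_one_sub [CharZero k] [∀ i, NeZero (d i)]
    (hcen : ∀ a, σ (unitBlocks k d) * a = a * σ (unitBlocks k d)) {δ : ℕ}
    (hδ : ∀ i, d i ≠ 1 → δ ∣ d i) :
    δ ^ 2 ∣ Module.finrank k (LinearMap.range (hitL (1 - σ (unitBlocks k d)))) := by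
  set F := 1 - σ (unitBlocks k d) with hF
  have hFc : ∀ a, F * a = a * F := fun a => by rw [hF, sub_mul, mul_sub, hcen, one_mul, mul_one]
  have hFF : F * F = F := by
    rw [hF, mul_sub, sub_mul, sub_mul, ← map_mul, unitBlocks_mul_self, one_mul, mul_one,
      one_mul, sub_self, sub_zero]
  have hFe : ∀ i, F * σ (Pi.single i 1) = if d i = 1 then 0 else σ (Pi.single i 1) := fun i => by
    rw [hF, sub_mul, ← map_mul, unitBlocks_mul_single, one_mul]
    split_ifs
    · exact sub_self _
    · rw [map_zero, sub_zero]
  let Q : Fin n × Fin n → Module.End k H := fun u =>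
    hitL (F * σ (Pi.single u.1 1)) ∘ₗ hitR (F * σ (Pi.single u.2 1))
  have hQ : ∀ u, (δ ^ 2 ∣ Module.finrank k (LinearMap.range (Q u))) ∧
      IsIdempotentElem (Q u) := by
    rintro ⟨i, j⟩
    by_cases hi : d i = 1
    · have : Q (i, j) = 0 := LinearMap.ext fun x => by
        simp only [Q, hFe, if_pos hi, LinearMap.comp_apply, hitL_zero, LinearMap.zero_apply]
      rw [this, show LinearMap.range (0 : Module.End k H) = ⊥ from LinearMap.range_zero,
        finrank_bot]
      exact ⟨dvd_zero _, mul_zero _⟩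
    by_cases hj : d j = 1
    · have : Q (i, j) = 0 := LinearMap.ext fun x => by
        simp only [Q, hFe, if_pos hj, LinearMap.comp_apply, hitR_zero, map_zero,
          LinearMap.zero_apply]
      rw [this, show LinearMap.range (0 : Module.End k H) = ⊥ from LinearMap.range_zero,
        finrank_bot]
      exact ⟨dvd_zero _, mul_zero _⟩
    have : Q (i, j) = hitL (σ (Pi.single i 1)) ∘ₗ hitR (σ (Pi.single j 1)) := by
      simp only [Q, hFe, if_neg hi, if_neg hj]
    rw [this, finrank_range_hitL_comp_hitR, ← mul_assoc, sq]
    refine ⟨Dvd.dvd.mul_right (mul_dvd_mul (hδ i hi) (hδ j hj)) _, LinearMap.ext fun x => ?_⟩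
    simp only [Module.End.mul_apply, LinearMap.comp_apply]
    rw [← hitL_hitR, ← hitR_mul, ← hitL_mul, section_single_mul_self, section_single_mul_self]
  have hsum : ∑ u, Q u = hitL F := by
    refine LinearMap.ext fun x => ?_
    rw [LinearMap.sum_apply]
    refine (sum_hitL_hitR (fun i => F * σ (Pi.single i 1)) (fun i => F * σ (Pi.single i 1))
      x).trans ?_
    rw [← Finset.mul_sum, sum_section_single, mul_one, hitR_eq_hitL_of_central hFc, ← hitL_mul, hFF]
  rw [← hsum, finrank_range_sum_of_isIdempotentElem _ (fun u _ => (hQ u).2)]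
  · exact Finset.dvd_sum fun u _ => (hQ u).1
  · rw [hsum]
    exact LinearMap.ext fun x => by rw [Module.End.mul_apply, ← hitL_mul, hFF]

omit [FiniteDimensional k H] in
lemma ker_hitL_one_sub (E : WithConv (H →ₗ[k] k)) :
    LinearMap.ker (hitL (1 - E)) = fixedPart E := by
  ext x
  have h : hitL (1 - E) x = x - hitL E x := ext_conv (k := k) fun a => by
    rw [← conv_apply_eq_hitL, one_sub_mul, map_sub, ← conv_apply_eq_hitL]
    rfl
  rw [LinearMap.mem_ker, h, sub_eq_zero, eq_comm]
  rfl

end Rank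

end HopfClass

open HopfClass in
/-- Suppose the grouplikes of `H` have order `p` and `P₁^{g,E} = 0 = P₁^{E,g}` for every
grouplike `g` and every simple subcoalgebra `E` of dimension `> 1`. Then `P^{g,E} = 0 =
P^{E,g}` for all such `g, E`. If moreover `H` contains a sub-Hopf algebra `T` isomorphic to a
Taft algebra of dimension `p²`, then `Σ_{g,h ∈ G(H)} P^{g,h} ⊕ kG(H) = T`, and if every
simple subcoalgebra of dimension `> 1` has dimension divisible by `d²` with `1 < d² < p²`,
then `d²` divides `p − 1`. -/
theorem Pcomp_grouplike_simple_eq_bot_and_taft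
    (k : Type*) [Field k] [IsAlgClosed k] [CharZero k]
    (H : Type*) [Ring H] [HopfAlgebra k H] [FiniteDimensional k H]
    (p : ℕ) (hp : p.Prime) (hodd : Odd p)
    (hdim : Module.finrank k H = p ^ 3)
    (hnss : ¬ IsSemisimpleRing H) (hnp : ¬ IsPointed k H) (hncop : ¬ IsCopointed k H)
    (hG : (grouplikes k H).ncard = p)
    (π₀ : H →ₗ[k] H)
    (hproj : ∀ x ∈ coradical k H, π₀ x = x)
    (hrange : LinearMap.range π₀ = coradical k H)
    (hcoalg : TensorProduct.map π₀ π₀ ∘ₗ comulL k H = comulL k H ∘ₗ π₀)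
    (hcounit : (Coalgebra.counit : H →ₗ[k] k) ∘ₗ π₀ = Coalgebra.counit)
    (hP1 : ∀ g ∈ grouplikes k H, ∀ E : Submodule k H,
      IsSimpleSubcoalgWrt k (comulL k H) E → 1 < Module.finrank k ↥E →
      Pcomp k H π₀ 1 (Submodule.span k {g}) E = ⊥ ∧
      Pcomp k H π₀ 1 E (Submodule.span k {g}) = ⊥) :
    (∀ g ∈ grouplikes k H, ∀ E : Submodule k H,
      IsSimpleSubcoalgWrt k (comulL k H) E → 1 < Module.finrank k ↥E →
      (⨆ n, Pcomp k H π₀ n (Submodule.span k {g}) E) = ⊥ ∧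
      (⨆ n, Pcomp k H π₀ n E (Submodule.span k {g})) = ⊥) ∧
    (∀ (q : k) (T : Subalgebra k H), IsTaftSubalgebra k p q T →
      ((⨆ g ∈ grouplikes k H, ⨆ h ∈ grouplikes k H,
          ⨆ n, Pcomp k H π₀ n (Submodule.span k {g}) (Submodule.span k {h})) ⊔
        Submodule.span k (grouplikes k H) = Subalgebra.toSubmodule T) ∧
      (∀ d : ℕ, 1 < d ^ 2 → d ^ 2 < p ^ 2 →
        (∀ E : Submodule k H, IsSimpleSubcoalgWrt k (comulL k H) E →
          1 < Module.finrank k ↥E → d ^ 2 ∣ Module.finrank k ↥E) →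
        d ^ 2 ∣ (p - 1))) := by
  have : FiniteDimensional k (WithConv (H →ₗ[k] k)) :=
    (WithConv.linearEquiv k (H →ₗ[k] k)).symm.finiteDimensional
  obtain ⟨n, d, φ, hd, hφ, N, hN⟩ := exists_algHom_pi_matrix k (WithConv (H →ₗ[k] k))
  obtain ⟨σ, hφσ, hσ⟩ := exists_section hN hφ hproj hrange hcoalg hcounit
  have hsimple : ∀ i, IsSimpleSubcoalgWrt k (comulL k H) (block φ i) := fun i =>
    (isSimpleSubcoalg_iff hφ hN).2 ⟨i, rfl⟩
  have hbig : ∀ i, d i ≠ 1 → 1 < Module.finrank k (block φ i) := fun i hi => by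
    rw [finrank_block hφ]
    exact Nat.one_lt_pow two_ne_zero (by have := NeZero.pos (d i); omega)
  have hP : ∀ i j, ¬(d i = 1 ↔ d j = 1) → Pcomp k H π₀ 1 (block φ i) (block φ j) = ⊥ := by
    intro i j hij
    by_cases hi : d i = 1
    · obtain ⟨g, hg, hgi⟩ := exists_isGrouplike_span_eq_block (φ := φ) hφ hi
      rw [← hgi]
      exact (hP1 g hg _ (hsimple j) (hbig j (by tauto))).1
    · obtain ⟨g, hg, hgj⟩ := exists_isGrouplike_span_eq_block (φ := φ) hφ (i := j) (by tauto)
      rw [← hgj]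
      exact (hP1 g hg _ (hsimple i) (hbig i hi)).2
  have hmix : ∀ {i j}, ¬(d i = 1 ↔ d j = 1) →
      ∀ f, σ (Pi.single i 1) * f * σ (Pi.single j 1) = 0 := fun hij f =>
    mul_mul_eq_zero_of_Pcomp_one_eq_bot hφσ hσ hN hrange hcoalg hP hij f
  refine ⟨fun g hg E hE hE1 => ?_, fun q T hT => ?_⟩
  · obtain ⟨i, hi, hgi⟩ := exists_span_eq_block_of_isGrouplike hφ hN hg
    obtain ⟨j, rfl⟩ := (isSimpleSubcoalg_iff hφ hN).1 hE
    have hj : d j ≠ 1 := fun hj => by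
      rw [finrank_block hφ, hj, one_pow] at hE1
      exact lt_irrefl _ hE1
    rw [hgi, iSup_eq_bot, iSup_eq_bot]
    exact ⟨Pcomp_eq_bot_of_mul_mul_eq_zero hφσ hσ (hmix (by tauto)),
      Pcomp_eq_bot_of_mul_mul_eq_zero hφσ hσ (hmix (by tauto))⟩
  · have hcen : ∀ a, σ (unitBlocks k d) * a = a * σ (unitBlocks k d) :=
      section_unitBlocks_central hmix
    have hne : fixedPart (σ (unitBlocks k d)) ≠ ⊤ := by
      intro htop
      refine hnp fun C hC => ?_
      obtain ⟨i, rfl⟩ := (isSimpleSubcoalg_iff hφ hN).1 hC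
      rw [finrank_block hφ]
      suffices hi : d i = 1 by rw [hi, one_pow]
      by_contra hi
      have h0 := hitL_section_single_eq_zero hi
        (show coeff φ i 0 0 ∈ fixedPart (σ (unitBlocks k d)) from htop ▸ Submodule.mem_top)
      obtain ⟨f, hf⟩ := hφ (blockUnit i 0 0)
      have h1 := apply_coeff φ f i 0 0
      rw [hf, blockUnit_apply_same, if_pos ⟨rfl, rfl⟩] at h1
      have h2 := one_sub_section_single_apply hφσ (coeff_mem_block φ i 0 0)
      rw [hitL_coeff, hφσ, Pi.single_eq_same] at h0
      simp only [Matrix.one_apply, ite_smul, one_smul, zero_smul, Finset.sum_ite_eq,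
        Finset.mem_univ, if_true] at h0
      rw [h0, map_zero] at h1
      exact zero_ne_one h1
    have hfix := fixedPart_eq_of_isTaftSubalgebra hφ hφσ hσ hN hcen
      (fun B hB => finrank_dvd_finrank_of_subbialgebra hB) hp hdim hne hT
    refine ⟨(iSup_Pcomp_sup_span_eq_fixedPart hφ hφσ hσ hN hrange hcoalg hcen).trans hfix,
      fun δ hδ1 hδp hδ => ?_⟩
    have hdvd := sq_dvd_finrank_range_hitL_one_sub hcen (δ := δ) fun i hi => by
      have := hδ _ (hsimple i) (hbig i hi)
      rwa [finrank_block hφ, Nat.pow_dvd_pow_iff two_ne_zero] at this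
    have hrank := LinearMap.finrank_range_add_finrank_ker (hitL (1 - σ (unitBlocks k d)))
    rw [ker_hitL_one_sub, hfix, hdim, Subalgebra.finrank_toSubmodule, hT.2.1] at hrank
    have hp1 := hp.one_lt
    have hrank' : Module.finrank k (LinearMap.range (hitL (1 - σ (unitBlocks k d)))) =
        p ^ 2 * (p - 1) := by
      rw [Nat.mul_sub, mul_one, ← pow_succ, show 2 + 1 = 3 from rfl]
      omega
    rw [hrank'] at hdvd
    have hδ0 : δ ≠ 0 := by
      rintro rfl
      simp at hδ1
    exact ((Nat.coprime_of_lt_prime hδ0 (lt_of_pow_lt_pow_left₀ 2 (Nat.zero_le p) hδp)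
      hp).symm.pow 2 2).dvd_of_dvd_mul_left hdvd
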